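/- arXiv:1408.3908 — 3 statements merged into one kernel-verified Lean document; each statement's English description precedes it below -/
import Mathlib

section
/- Let λ : ℕ → [0,∞) be a sequence, let m : [0,∞) → [0,∞) satisfy m(x) ≥ μ₁ > 0 for every x ≥ 0 and |m(a) − m(b)| ≤ ω_m(|a−b|) for all a,b ≥ 0, where ω_m is a continuity modulus. Let σ ∈ (0,1/2] and δ > 0, and let α ∈ [0,1/4) satisfy limsup_{x→0⁺} (ω_m(x))^{4α} / x^{1−2σ} < +∞. Then there exists ε₁ > 0, independent of the choice of continuity modulus ω_d below, with the following property: for every continuity modulus ω_d with ω_d(1) = 1, ω_d(x) ≤ x^{4α} for every x ≥ 0, and lim_{x→0⁺} ω_d(x)/x^{4α} = 0, and for every (u⁰,u¹) ∈ V_{ω_d} with |u¹|² + |A^{1/2}u⁰|² + ‖(u⁰,u¹)‖_{ω_d}² ≤ ε₁, every solution on some interval [0,T] of the Kirchhoff equation u'' + 2δ A^σ u' + m(|A^{1/2}u|²) A u = 0 with initial data (u⁰,u¹) and with (u(t),u'(t)) ∈ V_{ω_d} continuously in t, can be continued to a global solution on [0,+∞) belonging to C⁰([0,+∞), D(A^{1/2}))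 ∩ C¹([0,+∞), H) with (u(t),u'(t)) ∈ V_{ω_d} continuously in t. -/
open Set Filter MeasureTheory Topology

noncomputable section

/-- A continuity modulus: continuous on `[0,∞)`, vanishing at `0`, positive for positive
arguments, nondecreasing, and such that `x ↦ x / ω x` is nondecreasing on `(0,∞)`. -/
def IsModulus (ω : ℝ → ℝ) : Prop :=
  ContinuousOn ω (Ici 0) ∧ ω 0 = 0 ∧ (∀ x : ℝ, 0 < x → 0 < ω x) ∧
  (∀ x y : ℝ, 0 ≤ x → x ≤ y → ω x ≤ ω y) ∧
  (∀ x y : ℝ, 0 < x → x ≤ y → x / ω x ≤ y / ω y)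

/-- The curve `t ↦ (v t k)_k` takes values in `ℓ²` and is continuous on `I`
with respect to the `ℓ²` norm. -/
def L2Cont (I : Set ℝ) (v : ℝ → ℕ → ℝ) : Prop :=
  (∀ t ∈ I, Summable fun k => (v t k) ^ 2) ∧
  ∀ t ∈ I, ∀ ε : ℝ, 0 < ε → ∃ η > (0:ℝ), ∀ s ∈ I, |s - t| < η →
    (∑' k, (v s k - v t k) ^ 2) < ε

/-- A solution on the interval `I` (which contains `0`) of the Kirchhoff equation
`u'' + 2δ A^σ u' + m(|A^{1/2}u|²) A u = 0` with initial data `(u0, u1)`, in the diagonal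
setting where `A` multiplies the `k`-th component by `lam k ^ 2`.  Each component is `C²`
on `I`, satisfies the componentwise ODE, and the curves `t ↦ u(t)`, `t ↦ A^{1/2}u(t)`,
`t ↦ u'(t)` are continuous with values in `ℓ²`. -/
def IsKirchhoffSol (lam : ℕ → ℝ) (m : ℝ → ℝ) (σ δ : ℝ) (I : Set ℝ)
    (u0 u1 : ℕ → ℝ) (u : ℕ → ℝ → ℝ) : Prop :=
  (∀ k, ContDiffOn ℝ 2 (u k) I) ∧
  (∀ k, u k 0 = u0 k) ∧
  (∀ k, derivWithin (u k) I 0 = u1 k) ∧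
  (∀ k, ∀ t ∈ I,
    derivWithin (derivWithin (u k) I) I t
      + 2 * δ * lam k ^ (2 * σ) * derivWithin (u k) I t
      + m (∑' j, lam j ^ 2 * u j t ^ 2) * lam k ^ 2 * u k t = 0) ∧
  L2Cont I (fun t k => u k t) ∧
  L2Cont I (fun t k => lam k * u k t) ∧
  L2Cont I (fun t k => derivWithin (u k) I t)

/-- The `k`-th summand of the squared seminorm `‖(u0,u1)‖_{ωd}²` of the interpolation
space `V_{ωd}`: it equals `((u1 k)² + (lam k)² (u0 k)²) / ωd (1 / lam k)` when
`lam k > 0`, and `0` otherwise. -/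
def Vsum (lam : ℕ → ℝ) (ωd : ℝ → ℝ) (u0 u1 : ℕ → ℝ) (k : ℕ) : ℝ :=
  if 0 < lam k then (u1 k ^ 2 + lam k ^ 2 * u0 k ^ 2) / ωd (1 / lam k) else 0

/-- Membership in the interpolation space `V_{ωd}` (inside `D(A^{1/2}) × H`). -/
def MemV (lam : ℕ → ℝ) (ωd : ℝ → ℝ) (u0 u1 : ℕ → ℝ) : Prop :=
  (Summable fun k => u0 k ^ 2) ∧ (Summable fun k => lam k ^ 2 * u0 k ^ 2) ∧
  (Summable fun k => u1 k ^ 2) ∧ Summable (Vsum lam ωd u0 u1)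

/-- The curve `t ↦ (u(t), u'(t))` lies in `V_{ωd}` for every `t ∈ I` and the weighted
curves `t ↦ ((ωd(1/λ_k))^{-1/2} λ_k u_k(t))_k` and `t ↦ ((ωd(1/λ_k))^{-1/2} u_k'(t))_k`
(over `k` with `λ_k > 0`) are continuous with values in `ℓ²`. -/
def VRegCurves (lam : ℕ → ℝ) (ωd : ℝ → ℝ) (I : Set ℝ) (u : ℕ → ℝ → ℝ) : Prop :=
  (∀ t ∈ I, Summable (Vsum lam ωd (fun k => u k t) (fun k => derivWithin (u k) I t))) ∧
  L2Cont I (fun t k =>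
    if 0 < lam k then lam k * u k t / Real.sqrt (ωd (1 / lam k)) else 0) ∧
  L2Cont I (fun t k =>
    if 0 < lam k then derivWithin (u k) I t / Real.sqrt (ωd (1 / lam k)) else 0)

/-- The pair `(y, z)` solves `y' = z`, `z' = -(a z + b c(t) y)` on `J`. -/
structure IsOscillatorOn (J : Set ℝ) (a b : ℝ) (c y z : ℝ → ℝ) : Prop where
  pos : ∀ t ∈ J, HasDerivWithinAt y (z t) J t
  vel : ∀ t ∈ J, HasDerivWithinAt z (-(a * z t + b * c t * y t)) J t

theorem IsOscillatorOn.mono {J J' : Set ℝ} {a b : ℝ} {c y z : ℝ → ℝ}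
    (h : IsOscillatorOn J a b c y z) (hJ : J' ⊆ J) : IsOscillatorOn J' a b c y z :=
  ⟨fun t ht => (h.pos t (hJ ht)).mono hJ, fun t ht => (h.vel t (hJ ht)).mono hJ⟩

theorem IsOscillatorOn.congr_coeff {J : Set ℝ} {a b : ℝ} {c c' y z : ℝ → ℝ}
    (h : IsOscillatorOn J a b c y z) (hc : ∀ t ∈ J, c t = c' t) :
    IsOscillatorOn J a b c' y z :=
  ⟨h.pos, fun t ht => by rw [← hc t ht]; exact h.vel t ht⟩

/-- Vector field of the first order system associated with the oscillator. -/
def oscField (a b : ℝ) (c : ℝ → ℝ) (t : ℝ) (x : ℝ × ℝ) : ℝ × ℝ :=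
  (x.2, -(a * x.2 + b * c t * x.1))

theorem norm_oscField_sub_le {a b M : ℝ} {c : ℝ → ℝ} {t : ℝ} (hc : |c t| ≤ M) (x x' : ℝ × ℝ) :
    ‖oscField a b c t x - oscField a b c t x'‖ ≤ (1 + |a| + |b| * M) * ‖x - x'‖ := by
  have hM : 0 ≤ M := (abs_nonneg _).trans hc
  have h1 : |x.1 - x'.1| ≤ ‖x - x'‖ := norm_fst_le (x - x')
  have h2 : |x.2 - x'.2| ≤ ‖x - x'‖ := norm_snd_le (x - x')
  have hN := norm_nonneg (x - x')
  have hbM : 0 ≤ |b| * M := by positivity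
  rw [Prod.norm_def]
  refine max_le ?_ ?_
  · change |x.2 - x'.2| ≤ _
    nlinarith [abs_nonneg a]
  · change |-(a * x.2 + b * c t * x.1) - -(a * x'.2 + b * c t * x'.1)| ≤ _
    rw [show -(a * x.2 + b * c t * x.1) - -(a * x'.2 + b * c t * x'.1) =
      -(a * (x.2 - x'.2) + b * c t * (x.1 - x'.1)) by ring, abs_neg]
    refine (abs_add_le _ _).trans ?_
    rw [abs_mul, abs_mul, abs_mul]
    have h3 : |a| * |x.2 - x'.2| ≤ |a| * ‖x - x'‖ := by gcongr
    have h4 : |b| * |c t| * |x.1 - x'.1| ≤ |b| * M * ‖x - x'‖ := by gcongr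
    nlinarith

theorem lipschitzWith_oscField {a b M : ℝ} {c : ℝ → ℝ} {t : ℝ} (hc : |c t| ≤ M) :
    LipschitzWith (1 + |a| + |b| * M).toNNReal (oscField a b c t) := by
  refine LipschitzWith.of_dist_le' fun x x' => ?_
  rw [dist_eq_norm, dist_eq_norm]
  exact norm_oscField_sub_le hc x x'

theorem IsOscillatorOn.hasDerivWithinAt_prod {J : Set ℝ} {a b : ℝ} {c y z : ℝ → ℝ}
    (h : IsOscillatorOn J a b c y z) {t : ℝ} (ht : t ∈ J) :
    HasDerivWithinAt (fun τ => (y τ, z τ)) (oscField a b c t (y t, z t)) J t :=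
  (h.pos t ht).prodMk (h.vel t ht)

/-- Continuous dependence of an oscillator on its coefficient. -/
theorem IsOscillatorOn.abs_sub_le {s a b M ε : ℝ} {c c' y z y' z' : ℝ → ℝ}
    (h : IsOscillatorOn (Icc 0 s) a b c y z) (h' : IsOscillatorOn (Icc 0 s) a b c' y' z')
    (hy : y 0 = y' 0) (hz : z 0 = z' 0) (hM : ∀ t ∈ Icc 0 s, |c t| ≤ M)
    (hε : ∀ t ∈ Icc 0 s, |c' t - c t| * |y' t| ≤ ε) :
    ∀ t ∈ Icc 0 s,
      |y t - y' t| ≤ gronwallBound 0 (1 + |a| + |b| * M).toNNReal (|b| * ε) t ∧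
      |z t - z' t| ≤ gronwallBound 0 (1 + |a| + |b| * M).toNNReal (|b| * ε) t := by
  intro t ht
  have hmem : ∀ {τ}, τ ∈ Ico 0 s → Icc 0 s ∈ 𝓝[Ici τ] τ := fun {τ} hτ =>
    Filter.mem_of_superset (Icc_mem_nhdsGE hτ.2) (Icc_subset_Icc_left hτ.1)
  have key := dist_le_of_approx_trajectories_ODE_of_mem (a := 0) (b := s)
    (v := oscField a b c) (s := fun _ => univ) (K := (1 + |a| + |b| * M).toNNReal)
    (f := fun τ => (y τ, z τ)) (g := fun τ => (y' τ, z' τ))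
    (f' := fun τ => oscField a b c τ (y τ, z τ))
    (g' := fun τ => oscField a b c' τ (y' τ, z' τ)) (δ := 0) (εf := 0) (εg := |b| * ε)
    (fun τ hτ => (lipschitzWith_oscField (hM τ (Ico_subset_Icc_self hτ))).lipschitzOnWith)
    (fun τ hτ => (h.hasDerivWithinAt_prod hτ).continuousWithinAt)
    (fun τ hτ => (h.hasDerivWithinAt_prod (Ico_subset_Icc_self hτ)).mono_of_mem_nhdsWithin
      (hmem hτ))
    (fun τ _ => by simp) (fun _ _ => trivial)
    (fun τ hτ => (h'.hasDerivWithinAt_prod hτ).continuousWithinAt)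
    (fun τ hτ => (h'.hasDerivWithinAt_prod (Ico_subset_Icc_self hτ)).mono_of_mem_nhdsWithin
      (hmem hτ))
    (fun τ hτ => by
      have := hε τ (Ico_subset_Icc_self hτ)
      rw [dist_eq_norm, Prod.norm_def]
      refine max_le ?_ ?_
      · have h0 : (0:ℝ) ≤ ε := le_trans (by positivity) this
        simp only [oscField, Prod.fst_sub, sub_self, norm_zero]
        positivity
      · simp only [oscField, Prod.snd_sub, Real.norm_eq_abs]
        rw [show -(a * z' τ + b * c' τ * y' τ) - -(a * z' τ + b * c τ * y' τ) =
          -(b * ((c' τ - c τ) * y' τ)) by ring, abs_neg, abs_mul, abs_mul]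
        gcongr)
    (fun _ _ => trivial) (by simp [hy, hz]) t ht
  rw [sub_zero, zero_add, dist_eq_norm, Prod.norm_def] at key
  exact ⟨(le_max_left _ _).trans key, (le_max_right _ _).trans key⟩

theorem IsOscillatorOn.unique {s a b M : ℝ} {c y z y' z' : ℝ → ℝ}
    (h : IsOscillatorOn (Icc 0 s) a b c y z) (h' : IsOscillatorOn (Icc 0 s) a b c y' z')
    (hy : y 0 = y' 0) (hz : z 0 = z' 0) (hM : ∀ t ∈ Icc 0 s, |c t| ≤ M) :
    ∀ t ∈ Icc 0 s, y t = y' t ∧ z t = z' t := by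
  intro t ht
  have := h.abs_sub_le h' hy hz hM (ε := 0) (fun τ _ => by simp) t ht
  rw [mul_zero, gronwallBound_ε0_δ0] at this
  exact ⟨sub_eq_zero.1 (abs_nonpos_iff.1 this.1), sub_eq_zero.1 (abs_nonpos_iff.1 this.2)⟩

/-- Truncation of a real number to `[-R, R]`. -/
def clampAbs (R x : ℝ) : ℝ := max (-R) (min R x)

theorem abs_clampAbs_sub_le (R x y : ℝ) : |clampAbs R x - clampAbs R y| ≤ |x - y| := by
  unfold clampAbs
  rw [max_comm (-R), max_comm (-R)]
  refine (abs_max_sub_max_le_abs _ _ _).trans ((abs_min_sub_min_le_max _ _ _ _).trans ?_)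
  simp

theorem abs_clampAbs_le {R : ℝ} (hR : 0 ≤ R) (x : ℝ) : |clampAbs R x| ≤ R :=
  abs_le.2 ⟨le_max_left _ _, max_le (by linarith) (min_le_left _ _)⟩

theorem clampAbs_of_abs_le {R x : ℝ} (h : |x| ≤ R) : clampAbs R x = x := by
  rw [clampAbs, min_eq_right (abs_le.1 h).2, max_eq_right (abs_le.1 h).1]

theorem abs_clampAbs_le_abs {R : ℝ} (hR : 0 ≤ R) (x : ℝ) : |clampAbs R x| ≤ |x| := by
  have := abs_clampAbs_sub_le R x 0
  rwa [clampAbs_of_abs_le (by simpa using hR : |(0:ℝ)| ≤ R), sub_zero, sub_zero] at this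

theorem exists_isOscillatorOn_Icc (a b : ℝ) {M : ℝ} {c : ℝ → ℝ} (hc : Continuous c)
    (hM : ∀ t, |c t| ≤ M) (y₀ z₀ : ℝ) {S : ℝ} (hS : 0 ≤ S) :
    ∃ y z : ℝ → ℝ, y 0 = y₀ ∧ z 0 = z₀ ∧ IsOscillatorOn (Icc 0 S) a b c y z := by
  set K : ℝ := 1 + |a| + |b| * M with hK
  have hM0 : 0 ≤ M := (abs_nonneg _).trans (hM 0)
  have hK0 : 0 ≤ K := by positivity
  set R : ℝ := ‖(y₀, z₀)‖ * Real.exp (K * S) with hR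
  have hR0 : 0 ≤ R := by positivity
  let tr : ℝ × ℝ → ℝ × ℝ := fun x => (clampAbs R x.1, clampAbs R x.2)
  have htr : ∀ x x', ‖tr x - tr x'‖ ≤ ‖x - x'‖ := fun x x' => by
    rw [Prod.norm_def, Prod.norm_def]
    exact max_le_max (abs_clampAbs_sub_le _ _ _) (abs_clampAbs_sub_le _ _ _)
  have htr0 : ∀ x, ‖tr x‖ ≤ ‖x‖ := fun x => by
    rw [Prod.norm_def, Prod.norm_def]
    exact max_le_max (abs_clampAbs_le_abs hR0 _) (abs_clampAbs_le_abs hR0 _)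
  have htrR : ∀ x, ‖tr x‖ ≤ R := fun x => by
    rw [Prod.norm_def]
    exact max_le (abs_clampAbs_le hR0 _) (abs_clampAbs_le hR0 _)
  have htrid : ∀ x, ‖x‖ ≤ R → tr x = x := fun x hx => by
    rw [Prod.norm_def] at hx
    exact Prod.ext (clampAbs_of_abs_le ((le_max_left _ _).trans hx))
      (clampAbs_of_abs_le ((le_max_right _ _).trans hx))
  have hf0 : ∀ t x, ‖oscField a b c t x‖ ≤ K * ‖x‖ := fun t x => by
    have := norm_oscField_sub_le (a := a) (b := b) (hM t) x 0
    simpa [oscField] using this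
  have hPL : IsPicardLindelof (fun t x => oscField a b c t (tr x))
      (⟨0, left_mem_Icc.2 hS⟩ : Icc (0:ℝ) S) (y₀, z₀) (K * R * S).toNNReal 0
      (K * R).toNNReal K.toNNReal :=
    { lipschitzOnWith := fun t _ => by
        refine (LipschitzWith.of_dist_le' fun x x' => ?_).lipschitzOnWith
        rw [dist_eq_norm, dist_eq_norm]
        exact (norm_oscField_sub_le (hM t) _ _).trans
          (mul_le_mul_of_nonneg_left (htr x x') hK0)
      continuousOn := fun x _ => by
        unfold oscField
        fun_prop
      norm_le := fun t _ x _ => by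
        rw [Real.coe_toNNReal _ (by positivity)]
        exact (hf0 t _).trans (mul_le_mul_of_nonneg_left (htrR x) hK0)
      mul_max_le := by
        rw [Real.coe_toNNReal _ (by positivity), Real.coe_toNNReal _ (by positivity)]
        simp [hS] }
  obtain ⟨x, hx0, hx⟩ := hPL.exists_eq_forall_mem_Icc_hasDerivWithinAt₀
  have hmem : ∀ {τ}, τ ∈ Ico 0 S → Icc 0 S ∈ 𝓝[Ici τ] τ := fun {τ} hτ =>
    Filter.mem_of_superset (Icc_mem_nhdsGE hτ.2) (Icc_subset_Icc_left hτ.1)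
  have hxR : ∀ t ∈ Icc 0 S, ‖x t‖ ≤ R := by
    intro t ht
    have := norm_le_gronwallBound_of_norm_deriv_right_le (f := x) (a := 0) (b := S)
      (δ := ‖(y₀, z₀)‖) (K := K) (ε := 0)
      (fun τ hτ => (hx τ hτ).continuousWithinAt)
      (fun τ hτ => (hx τ (Ico_subset_Icc_self hτ)).mono_of_mem_nhdsWithin (hmem hτ))
      (by rw [← hx0]) (fun τ _ => by
        rw [add_zero]
        exact (hf0 τ _).trans (mul_le_mul_of_nonneg_left (htr0 _) hK0)) t ht
    rw [gronwallBound_ε0, sub_zero] at this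
    refine this.trans ?_
    rw [hR]
    gcongr
    exact ht.2
  refine ⟨fun t => (x t).1, fun t => (x t).2, by simpa using congrArg Prod.fst hx0,
    by simpa using congrArg Prod.snd hx0, fun t ht => ?_, fun t ht => ?_⟩
  · have := hx t ht
    rw [htrid _ (hxR t ht)] at this
    exact this.fst
  · have := hx t ht
    rw [htrid _ (hxR t ht)] at this
    exact this.snd

theorem exists_isOscillatorOn_Ici (a b : ℝ) {M : ℝ} {c : ℝ → ℝ} (hc : Continuous c)
    (hM : ∀ t, |c t| ≤ M) (y₀ z₀ : ℝ) :
    ∃ y z : ℝ → ℝ, y 0 = y₀ ∧ z 0 = z₀ ∧ IsOscillatorOn (Ici 0) a b c y z := by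
  choose y z hy hz hyz using fun n : ℕ =>
    exists_isOscillatorOn_Icc a b hc hM y₀ z₀ (Nat.cast_nonneg (α := ℝ) n)
  have huniq : ∀ m n : ℕ, ∀ t : ℝ, 0 ≤ t → t ≤ m → t ≤ n → y m t = y n t ∧ z m t = z n t := by
    intro m n t ht hm hn
    exact ((hyz m).mono (Icc_subset_Icc_right hm)).unique
      ((hyz n).mono (Icc_subset_Icc_right hn)) ((hy m).trans (hy n).symm)
      ((hz m).trans (hz n).symm) (fun τ _ => hM τ) t ⟨ht, le_rfl⟩
  have hglue : ∀ t : ℝ, 0 ≤ t → ∀ τ ∈ Icc 0 (t + 1),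
      y ⌈τ⌉₊ τ = y ⌈t + 1⌉₊ τ ∧ z ⌈τ⌉₊ τ = z ⌈t + 1⌉₊ τ := fun t ht τ hτ =>
    huniq _ _ τ hτ.1 (Nat.le_ceil τ) (hτ.2.trans (Nat.le_ceil _))
  have hnhds : ∀ t : ℝ, 0 ≤ t → Icc 0 (t + 1) ∈ 𝓝[Ici 0] t := fun t _ => by
    rw [← Ici_inter_Iic]
    exact inter_mem_nhdsWithin _ (Iic_mem_nhds (by linarith))
  refine ⟨fun t => y ⌈t⌉₊ t, fun t => z ⌈t⌉₊ t, by simp [hy], by simp [hz],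
    fun t ht => ?_, fun t ht => ?_⟩
  · have htm : t ∈ Icc 0 (t + 1) := ⟨ht, by linarith⟩
    have h1 := (((hyz ⌈t + 1⌉₊).mono (Icc_subset_Icc_right (Nat.le_ceil (t + 1)))).pos t
      htm).congr (fun τ hτ => (hglue t ht τ hτ).1) (hglue t ht t htm).1
    rw [← (hglue t ht t htm).2] at h1
    exact h1.mono_of_mem_nhdsWithin (hnhds t ht)
  · have htm : t ∈ Icc 0 (t + 1) := ⟨ht, by linarith⟩
    have h1 := (((hyz ⌈t + 1⌉₊).mono (Icc_subset_Icc_right (Nat.le_ceil (t + 1)))).vel t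
      htm).congr (fun τ hτ => (hglue t ht τ hτ).2) (hglue t ht t htm).2
    rw [← (hglue t ht t htm).2, ← (hglue t ht t htm).1] at h1
    exact h1.mono_of_mem_nhdsWithin (hnhds t ht)

/-- Uniform energy bound for a damped oscillator whose coefficient oscillates by at most `g`
on the time scale `ε`. The estimate compares `c` with its moving average on that scale. -/
theorem IsOscillatorOn.energy_le {d l κ D μ M ε g : ℝ} {c y z : ℝ → ℝ}
    (h : IsOscillatorOn (Ici 0) (2 * d) (l ^ 2) c y z)
    (hκ : 0 < κ) (hκd : κ ≤ d) (hD : κ * d ≤ D * l ^ 2) (hc : Continuous c)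
    (hμ : 0 < μ) (hlb : ∀ t, μ ≤ c t) (hub : ∀ t, c t ≤ M) (hε : 0 < ε)
    (hg : ∀ s t, |s - t| ≤ ε → |c s - c t| ≤ g)
    (hg1 : g ≤ ε * (κ * μ)) (hg2 : g ^ 2 * l ^ 2 ≤ 2 * μ * (d * κ)) (hD0 : 0 ≤ D) :
    ∀ t, 0 ≤ t → z t ^ 2 + l ^ 2 * y t ^ 2 ≤
      (2 + 3 * D + M) / min (1 / 2) μ * (z 0 ^ 2 + l ^ 2 * y 0 ^ 2) := by
  have hg0 : 0 ≤ g := (abs_nonneg _).trans (hg 0 0 (by simpa using hε.le))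
  have hd : 0 < d := hκ.trans_le hκd
  set G : ℝ → ℝ := fun t => ∫ s in (0:ℝ)..t, c s with hG
  have hGd : ∀ t, HasDerivAt G (c t) t := fun t =>
    intervalIntegral.integral_hasDerivAt_right (hc.intervalIntegrable _ _)
      (hc.stronglyMeasurableAtFilter _ _) hc.continuousAt
  set A : ℝ → ℝ := fun t => (G (t + ε) - G t) / ε with hA
  have hAd : ∀ t, HasDerivAt A ((c (t + ε) - c t) / ε) t := fun t =>
    (((hGd (t + ε)).comp_add_const t ε).sub (hGd t)).div_const ε
  have hAc : ∀ t, ∃ ξ, |ξ - t| ≤ ε ∧ A t = c ξ := by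
    intro t
    obtain ⟨ξ, hξ, h1⟩ := exists_hasDerivAt_eq_slope G c (by linarith : t < t + ε)
      (fun τ _ => (hGd τ).continuousAt.continuousWithinAt) (fun τ _ => hGd τ)
    refine ⟨ξ, ?_, ?_⟩
    · rw [abs_of_pos (by linarith [hξ.1])]; linarith [hξ.2]
    · rw [h1, hA]; simp
  set E : ℝ → ℝ := fun t => z t ^ 2 + 2 * κ * (y t * z t) + 2 * κ * d * y t ^ 2
    + l ^ 2 * (A t * y t ^ 2) with hE
  have hlow : ∀ t, min (1 / 2) μ * (z t ^ 2 + l ^ 2 * y t ^ 2) ≤ E t := by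
    intro t
    obtain ⟨ξ, -, h1⟩ := hAc t
    have h2 : μ ≤ A t := h1 ▸ hlb ξ
    have h3 : min (1 / 2) μ * z t ^ 2 ≤ 1 / 2 * z t ^ 2 := by gcongr; exact min_le_left _ _
    have h4 : min (1 / 2) μ * (l ^ 2 * y t ^ 2) ≤ A t * (l ^ 2 * y t ^ 2) := by
      gcongr; exact (min_le_right _ _).trans h2
    have h5 : κ * κ * y t ^ 2 ≤ κ * d * y t ^ 2 := by gcongr
    simp only [hE]
    nlinarith [sq_nonneg (z t + 2 * κ * y t)]
  have hup : ∀ t, E t ≤ (2 + 3 * D + M) * (z t ^ 2 + l ^ 2 * y t ^ 2) := by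
    intro t
    obtain ⟨ξ, -, h1⟩ := hAc t
    have h2 : A t ≤ M := h1 ▸ hub ξ
    have hM : 0 ≤ M := (hμ.le.trans (hlb 0)).trans (hub 0)
    have h4 : A t * (l ^ 2 * y t ^ 2) ≤ M * (l ^ 2 * y t ^ 2) := by gcongr
    have h5 : κ * κ * y t ^ 2 ≤ κ * d * y t ^ 2 := by gcongr
    have h6 : κ * d * y t ^ 2 ≤ D * l ^ 2 * y t ^ 2 := by gcongr
    have h7 : 0 ≤ (3 * D + M) * z t ^ 2 := by positivity
    have h8 : 0 ≤ l ^ 2 * y t ^ 2 := by positivity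
    simp only [hE]
    nlinarith [sq_nonneg (z t - κ * y t)]
  have hmono : AntitoneOn E (Ici 0) := by
    have hder : ∀ t ∈ Ici (0:ℝ), HasDerivWithinAt E
        (2 * z t * -(2 * d * z t + l ^ 2 * c t * y t)
          + 2 * κ * (z t * z t + y t * -(2 * d * z t + l ^ 2 * c t * y t))
          + 2 * κ * d * (2 * y t * z t)
          + l ^ 2 * ((c (t + ε) - c t) / ε * y t ^ 2 + A t * (2 * y t * z t))) (Ici 0) t := by
      intro t ht
      have hy := h.pos t ht
      have hz := h.vel t ht
      have hA' := (hAd t).hasDerivWithinAt (s := Ici 0)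
      have hy2 : HasDerivWithinAt (fun τ => y τ ^ 2) (2 * y t * z t) (Ici 0) t := by
        simpa using hy.fun_pow 2
      have hz2 : HasDerivWithinAt (fun τ => z τ ^ 2)
          (2 * z t * -(2 * d * z t + l ^ 2 * c t * y t)) (Ici 0) t := by
        simpa using hz.fun_pow 2
      exact (((hz2.add ((hy.mul hz).const_mul (2 * κ))).add (hy2.const_mul (2 * κ * d))).add
        ((hA'.mul hy2).const_mul (l ^ 2)))
    refine antitoneOn_of_hasDerivWithinAt_nonpos (convex_Ici 0)
      (fun t ht => (hder t ht).continuousWithinAt)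
      (fun t ht => (hder t (interior_subset ht)).mono interior_subset) (fun t _ => ?_)
    obtain ⟨ξ, hξ, h1⟩ := hAc t
    have h2 : |A t - c t| ≤ g := h1 ▸ hg ξ t hξ
    have h3 : (c (t + ε) - c t) / ε ≤ κ * μ := by
      rw [div_le_iff₀ hε, mul_comm]
      exact (le_abs_self _).trans ((hg _ _ (by simp [abs_of_pos hε])).trans hg1)
    have h4 : (c (t + ε) - c t) / ε * (l ^ 2 * y t ^ 2) ≤ κ * μ * (l ^ 2 * y t ^ 2) := by
      gcongr
    have h5 : κ * μ * (l ^ 2 * y t ^ 2) ≤ κ * c t * (l ^ 2 * y t ^ 2) := by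
      gcongr; exact hlb t
    have h6 : (A t - c t) ^ 2 ≤ g ^ 2 := sq_le_sq' (by linarith [abs_le.1 h2]) (abs_le.1 h2).2
    have h7 : 2 * (A t - c t) * l ^ 2 * (y t * z t) ≤
        2 * d * z t ^ 2 + κ * μ * (l ^ 2 * y t ^ 2) := by
      have h8 : (A t - c t) ^ 2 * l ^ 2 * (l ^ 2 * y t ^ 2) ≤
          2 * μ * (d * κ) * (l ^ 2 * y t ^ 2) := by
        refine mul_le_mul_of_nonneg_right (le_trans ?_ hg2) (by positivity)
        gcongr
      have h9 : 0 ≤ (2 * d * z t - (A t - c t) * l ^ 2 * y t) ^ 2 := sq_nonneg _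
      have h10 : 2 * d * (2 * (A t - c t) * l ^ 2 * (y t * z t)) ≤
          2 * d * (2 * d * z t ^ 2 + κ * μ * (l ^ 2 * y t ^ 2)) := by nlinarith
      exact le_of_mul_le_mul_left h10 (by positivity)
    have h11 : κ * z t ^ 2 ≤ d * z t ^ 2 := by gcongr
    nlinarith
  intro t ht
  have hmin : 0 < min (1 / 2) μ := lt_min (by norm_num) hμ
  rw [div_mul_eq_mul_div, le_div_iff₀ hmin, mul_comm]
  exact (hlow t).trans ((hmono self_mem_Ici ht ht).trans (hup 0))

/-- Time-uniform energy bound for every mode of a wave equation with fractional damping,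
when the propagation speed oscillates little compared with the damping. -/
theorem IsOscillatorOn.energy_le_of_small_oscillation {l σ δ μ M η : ℝ} {c y z : ℝ → ℝ}
    (h : IsOscillatorOn (Ici 0) (2 * δ * l ^ (2 * σ)) (l ^ 2) c y z)
    (hl : 0 ≤ l) (hσ0 : 0 < σ) (hσ : σ ≤ 1 / 2) (hδ : 0 < δ) (hc : Continuous c)
    (hμ : 0 < μ) (hlb : ∀ t, μ ≤ c t) (hub : ∀ t, c t ≤ M)
    (hη : η ≤ δ * μ) (hη2 : η ^ 2 ≤ 2 * μ * δ ^ 2)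
    (hosc : ∀ s t, |c s - c t| ≤ η)
    (hosc' : 1 ≤ l → ∀ s t, |s - t| ≤ 1 / l → |c s - c t| ≤ η * l ^ (2 * σ - 1)) :
    ∀ t, 0 ≤ t → z t ^ 2 + l ^ 2 * y t ^ 2 ≤
      (2 + 3 * δ ^ 2 + M) / min (1 / 2) μ * (z 0 ^ 2 + l ^ 2 * y 0 ^ 2) := by
  have hη0 : 0 ≤ η := (abs_nonneg _).trans (hosc 0 0)
  rcases hl.eq_or_lt with rfl | hl
  · intro t ht
    rw [Real.zero_rpow (by positivity)] at h
    have hz : z t = z 0 := by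
      refine (convex_Ici (0:ℝ)).is_const_of_fderivWithin_eq_zero (𝕜 := ℝ)
        (fun τ hτ => (h.vel τ hτ).differentiableWithinAt) (fun τ hτ => ?_) ht self_mem_Ici
      have := (h.vel τ hτ).hasFDerivWithinAt.fderivWithin (uniqueDiffOn_Ici 0 τ hτ)
      rw [this]
      ext
      simp
    have hM : 0 ≤ M := (hμ.le.trans (hlb 0)).trans (hub 0)
    have hmin : 0 < min (1 / 2) μ := lt_min (by norm_num) hμ
    have h1 : (1:ℝ) ≤ (2 + 3 * δ ^ 2 + M) / min (1 / 2) μ := by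
      rw [le_div_iff₀ hmin]
      have := min_le_left (1 / 2) μ
      nlinarith [sq_nonneg δ]
    rw [hz]
    nlinarith [sq_nonneg (z 0)]
  rw [mul_assoc] at h
  have hp : 0 < l ^ (2 * σ) := Real.rpow_pos_of_pos hl _
  rcases le_total 1 l with h1 | h1
  · have e1 : l ^ (2 * σ - 1) = l ^ (2 * σ) / l := by
      rw [Real.rpow_sub hl, Real.rpow_one]
    have e2 : l ^ (2 * σ) ≤ l := by
      simpa using Real.rpow_le_rpow_of_exponent_le h1 (by linarith : 2 * σ ≤ 1)
    rw [e1] at hosc'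
    have e3 : l ^ (2 * σ) * l ^ (2 * σ) ≤ l ^ 2 := by nlinarith
    refine h.energy_le (κ := δ * l ^ (2 * σ)) (ε := 1 / l) (by positivity) le_rfl ?_ hc hμ hlb hub
      (by positivity) (hosc' h1) ?_ ?_ (by positivity)
    · nlinarith [sq_nonneg δ]
    · have : η * l ^ (2 * σ) ≤ δ * μ * l ^ (2 * σ) := by gcongr
      rw [show η * (l ^ (2 * σ) / l) = 1 / l * (η * l ^ (2 * σ)) by ring]
      exact mul_le_mul_of_nonneg_left (by linarith) (by positivity)
    · rw [mul_pow, div_pow]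
      field_simp
      nlinarith [sq_nonneg (l ^ (2 * σ))]
  · have hq : 0 < l ^ (2 - 2 * σ) := Real.rpow_pos_of_pos hl _
    have e1 : l ^ (2 - 2 * σ) * l ^ (2 * σ) = l ^ 2 := by
      rw [← Real.rpow_add hl]; norm_num
    have e2 : l ^ (2 - 2 * σ) ≤ l ^ (2 * σ) :=
      Real.rpow_le_rpow_of_exponent_ge hl h1 (by linarith)
    refine h.energy_le (κ := δ * l ^ (2 - 2 * σ)) (ε := 1 / l ^ (2 - 2 * σ)) (g := η)
      (by positivity) (by gcongr) ?_ hc hμ hlb hub (by positivity) (fun s t _ => hosc s t) ?_ ?_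
      (by positivity)
    · nlinarith [sq_nonneg δ]
    · field_simp
      linarith
    · have e3 : 2 * μ * (δ * l ^ (2 * σ) * (δ * l ^ (2 - 2 * σ))) = 2 * μ * δ ^ 2 * l ^ 2 := by
        rw [← e1]; ring
      rw [e3]
      gcongr

theorem L2Cont.of_dominated {v : ℝ → ℕ → ℝ} (hc : ∀ k, ContinuousOn (fun t => v t k) (Ici 0))
    (hb : ∀ S, ∃ b : ℕ → ℝ, Summable b ∧ ∀ t ∈ Icc 0 S, ∀ k, v t k ^ 2 ≤ b k) :
    L2Cont (Ici 0) v := by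
  refine ⟨fun t ht => ?_, fun t ht ε hε => ?_⟩
  · obtain ⟨b, hbs, hb⟩ := hb t
    exact hbs.of_nonneg_of_le (fun k => sq_nonneg _) (hb t ⟨ht, le_rfl⟩)
  · obtain ⟨b, hbs, hb⟩ := hb (t + 1)
    have hnhds : Icc 0 (t + 1) ∈ 𝓝[Ici 0] t := by
      rw [← Ici_inter_Iic]
      exact inter_mem_nhdsWithin _ (Iic_mem_nhds (by linarith))
    have hlim : Tendsto (fun s => ∑' k, (v s k - v t k) ^ 2) (𝓝[Ici 0] t)
        (𝓝 (∑' _ : ℕ, (0:ℝ))) := by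
      refine tendsto_tsum_of_dominated_convergence (hbs.mul_left 4) (fun k => ?_) ?_
      · have : Tendsto (fun s => (v s k - v t k) ^ 2) (𝓝[Ici 0] t) (𝓝 ((v t k - v t k) ^ 2)) :=
          ((hc k t ht).tendsto.sub_const _).pow 2
        simpa using this
      · filter_upwards [hnhds] with s hs k
        rw [Real.norm_eq_abs, abs_of_nonneg (sq_nonneg _)]
        nlinarith [hb s hs k, hb t ⟨ht, by linarith⟩ k, sq_nonneg (v s k + v t k)]
    rw [tsum_zero] at hlim
    obtain ⟨η, hη, h⟩ := Metric.mem_nhdsWithin_iff.1 (hlim (Iio_mem_nhds hε))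
    exact ⟨η, hη, fun s hs hst => h ⟨by rwa [Metric.mem_ball, Real.dist_eq], hs⟩⟩

theorem L2Cont.continuousOn_tsum_sq {I : Set ℝ} {v : ℝ → ℕ → ℝ} (h : L2Cont I v) :
    ContinuousOn (fun t => ∑' k, v t k ^ 2) I := by
  intro t ht
  have hsub : ∀ s ∈ I, Summable fun k => (v s k - v t k) ^ 2 := fun s hs =>
    (((h.1 s hs).mul_left 2).add ((h.1 t ht).mul_left 2)).of_nonneg_of_le
      (fun k => sq_nonneg _) (fun k => by nlinarith [sq_nonneg (v s k + v t k)])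
  have hlim : Tendsto (fun s => ∑' k, (v s k - v t k) ^ 2) (𝓝[I] t) (𝓝 0) := by
    rw [Metric.tendsto_nhdsWithin_nhds]
    intro ε hε
    obtain ⟨η, hη, h'⟩ := h.2 t ht ε hε
    refine ⟨η, hη, fun {s} hs hst => ?_⟩
    rw [Real.dist_eq, sub_zero, abs_of_nonneg (tsum_nonneg fun k => sq_nonneg _)]
    exact h' s hs (by rwa [Real.dist_eq] at hst)
  set B := ∑' k, v t k ^ 2 with hB
  have hB0 : 0 ≤ B := tsum_nonneg fun k => sq_nonneg _
  rw [ContinuousWithinAt, Metric.tendsto_nhdsWithin_nhds]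
  intro ε hε
  set θ := ε / (2 * (B + 1)) with hθ
  have hθ0 : 0 < θ := by positivity
  have hθB : θ * B < ε / 2 := by
    rw [hθ, div_mul_eq_mul_div, div_lt_div_iff₀ (by positivity) (by norm_num)]
    nlinarith
  have hlim' : Tendsto (fun s => (1 + 1 / θ) * ∑' k, (v s k - v t k) ^ 2) (𝓝[I] t) (𝓝 0) := by
    simpa using hlim.const_mul (1 + 1 / θ)
  obtain ⟨η, hη, hη'⟩ := Metric.tendsto_nhdsWithin_nhds.1 hlim' (ε / 2) (by positivity)
  refine ⟨η, hη, fun {s} hs hst => ?_⟩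
  have h1 := hη' hs hst
  rw [Real.dist_eq, sub_zero] at h1
  replace h1 := (abs_lt.1 h1).2
  rw [Real.dist_eq, ← (h.1 s hs).tsum_sub (h.1 t ht)]
  have hs1 : Summable fun k => θ * v t k ^ 2 + (1 + 1 / θ) * (v s k - v t k) ^ 2 :=
    ((h.1 t ht).mul_left θ).add ((hsub s hs).mul_left _)
  have hle : ∀ k, |v s k ^ 2 - v t k ^ 2| ≤
      θ * v t k ^ 2 + (1 + 1 / θ) * (v s k - v t k) ^ 2 := by
    intro k
    have h2 : θ * (1 / θ) = 1 := by field_simp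
    have h3 : 0 < 1 / θ := by positivity
    generalize 1 / θ = τ at h2 h3
    have h4 : 0 ≤ τ * (θ * v t k - (v s k - v t k)) ^ 2 := by positivity
    have h5 : 0 ≤ τ * (θ * v t k + (v s k - v t k)) ^ 2 := by positivity
    have e1 : τ * (θ * v t k - (v s k - v t k)) ^ 2 =
      (θ * τ) * θ * v t k ^ 2 - 2 * (θ * τ) * (v t k * (v s k - v t k)) +
        τ * (v s k - v t k) ^ 2 := by ring
    have e2 : τ * (θ * v t k + (v s k - v t k)) ^ 2 =
      (θ * τ) * θ * v t k ^ 2 + 2 * (θ * τ) * (v t k * (v s k - v t k)) +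
        τ * (v s k - v t k) ^ 2 := by ring
    rw [e1, h2] at h4
    rw [e2, h2] at h5
    rw [abs_le]
    constructor <;> nlinarith [sq_nonneg (v s k - v t k)]
  have habs : Summable fun k => |v s k ^ 2 - v t k ^ 2| :=
    hs1.of_nonneg_of_le (fun k => abs_nonneg _) hle
  calc |∑' k, (v s k ^ 2 - v t k ^ 2)| ≤ ∑' k, |v s k ^ 2 - v t k ^ 2| := by
        simpa [Real.norm_eq_abs] using norm_tsum_le_tsum_norm (f := fun k => v s k ^ 2 - v t k ^ 2)
          (by simpa [Real.norm_eq_abs] using habs)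
    _ ≤ ∑' k, (θ * v t k ^ 2 + (1 + 1 / θ) * (v s k - v t k) ^ 2) := habs.tsum_le_tsum hle hs1
    _ = θ * B + (1 + 1 / θ) * ∑' k, (v s k - v t k) ^ 2 := by
        rw [((h.1 t ht).mul_left θ).tsum_add ((hsub s hs).mul_left _), tsum_mul_left,
          tsum_mul_left]
    _ < ε := by linarith

theorem IsModulus.nonneg {ω : ℝ → ℝ} (h : IsModulus ω) {x : ℝ} (hx : 0 ≤ x) : 0 ≤ ω x :=
  h.2.1 ▸ h.2.2.2.1 0 x le_rfl hx

theorem IsModulus.le_div_mul {ω : ℝ → ℝ} (h : IsModulus ω) {x y : ℝ} (hx : 0 < x) (hxy : x ≤ y) :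
    x / y ≤ ω x / ω y := by
  have hy := hx.trans_le hxy
  have h1 := h.2.2.2.2 x y hx hxy
  rw [div_le_div_iff₀ (h.2.2.1 x hx) (h.2.2.1 y hy)] at h1
  rw [div_le_div_iff₀ hy (h.2.2.1 y hy)]
  linarith

theorem Vsum_nonneg {lam : ℕ → ℝ} {ωd : ℝ → ℝ} (hω : IsModulus ωd) (y z : ℕ → ℝ) (k : ℕ) :
    0 ≤ Vsum lam ωd y z k := by
  unfold Vsum
  split_ifs with h
  · have := hω.2.2.1 _ (one_div_pos.2 h)
    positivity
  · exact le_rfl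

/-- The squared norm of `A^{1/2} y` varies with modulus `3 R ωd` along a curve that stays in the
ball of radius `√R` of the interpolation space. -/
theorem abs_tsum_sub_le_modulus {lam : ℕ → ℝ} (hlam : ∀ k, 0 ≤ lam k) {ωd : ℝ → ℝ}
    (hω : IsModulus ωd) {y z : ℕ → ℝ → ℝ} {s t R : ℝ} (hst : s ≤ t)
    (hy : ∀ k, ∀ τ ∈ Icc s t, HasDerivWithinAt (y k) (z k τ) (Icc s t) τ)
    (hV : ∀ τ ∈ Icc s t, Summable (Vsum lam ωd (fun k => y k τ) (fun k => z k τ)))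
    (hR : ∀ τ ∈ Icc s t, ∑' k, Vsum lam ωd (fun k => y k τ) (fun k => z k τ) k ≤ R)
    (hs : Summable fun k => lam k ^ 2 * y k s ^ 2)
    (ht : Summable fun k => lam k ^ 2 * y k t ^ 2) :
    |∑' k, lam k ^ 2 * y k t ^ 2 - ∑' k, lam k ^ 2 * y k s ^ 2| ≤ 3 * R * ωd (t - s) := by
  rcases hst.eq_or_lt with rfl | hst'
  · simp [hω.2.1]
  set h := t - s with hh
  have h0 : 0 < h := sub_pos.2 hst'
  have hωh : 0 < ωd h := hω.2.2.1 h h0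
  have hsm : s ∈ Icc s t := left_mem_Icc.2 hst
  have htm : t ∈ Icc s t := right_mem_Icc.2 hst
  have hpart : ∀ S : Finset ℕ, ∀ τ ∈ Icc s t,
      ∑ k ∈ S, Vsum lam ωd (fun k => y k τ) (fun k => z k τ) k ≤ R := fun S τ hτ =>
    ((hV τ hτ).sum_le_tsum S (fun k _ => Vsum_nonneg hω _ _ k)).trans (hR τ hτ)
  rw [← ht.tsum_sub hs]
  refine le_of_tendsto (ht.sub hs).hasSum.abs (Eventually.of_forall fun S => ?_)
  rw [← Finset.sum_filter_add_sum_filter_not S (fun k => 0 < lam k ∧ lam k * h < 1)]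
  refine (abs_add_le _ _).trans ?_
  have hlow : |∑ k ∈ S with 0 < lam k ∧ lam k * h < 1,
      (lam k ^ 2 * y k t ^ 2 - lam k ^ 2 * y k s ^ 2)| ≤ R * ωd h := by
    have hder : ∀ τ ∈ Icc s t, HasDerivWithinAt
        (fun τ => ∑ k ∈ S with 0 < lam k ∧ lam k * h < 1, lam k ^ 2 * y k τ ^ 2)
        (∑ k ∈ S with 0 < lam k ∧ lam k * h < 1, lam k ^ 2 * (2 * y k τ * z k τ))
        (Icc s t) τ := by
      intro τ hτ
      refine HasDerivWithinAt.fun_sum fun k _ => ?_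
      have := ((hy k τ hτ).fun_pow 2).const_mul (lam k ^ 2)
      simpa using this
    have hbound : ∀ τ ∈ Icc s t,
        ‖∑ k ∈ S with 0 < lam k ∧ lam k * h < 1, lam k ^ 2 * (2 * y k τ * z k τ)‖ ≤
          ωd h / h * R := by
      intro τ hτ
      refine (norm_sum_le _ _).trans ?_
      refine le_trans ?_ (mul_le_mul_of_nonneg_left
        (hpart (S.filter fun k => 0 < lam k ∧ lam k * h < 1) τ hτ) (by positivity))
      rw [Finset.mul_sum]
      refine Finset.sum_le_sum fun k hk => ?_
      obtain ⟨hk1, hk2⟩ := (Finset.mem_filter.1 hk).2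
      have hw := hω.2.2.1 _ (one_div_pos.2 hk1)
      rw [Vsum, if_pos hk1, Real.norm_eq_abs]
      have h1 : lam k ≤ ωd h / h / ωd (1 / lam k) := by
        have := hω.le_div_mul h0 (by rw [le_div_iff₀ hk1]; linarith : h ≤ 1 / lam k)
        rw [div_div, mul_comm h, ← div_div, le_div_iff₀ h0]
        simpa [mul_comm] using this
      have h2 : |lam k ^ 2 * (2 * y k τ * z k τ)| ≤
          lam k * (z k τ ^ 2 + lam k ^ 2 * y k τ ^ 2) := by
        rw [show lam k ^ 2 * (2 * y k τ * z k τ) = lam k * (2 * (lam k * y k τ) * z k τ) by ring,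
          abs_mul, abs_of_pos hk1]
        refine mul_le_mul_of_nonneg_left (abs_le.2 ⟨?_, ?_⟩) hk1.le <;>
          nlinarith [sq_nonneg (lam k * y k τ + z k τ), sq_nonneg (lam k * y k τ - z k τ)]
      refine h2.trans ?_
      rw [← mul_div_assoc, mul_div_right_comm]
      gcongr
    have := (convex_Icc s t).norm_image_sub_le_of_norm_hasDerivWithin_le hder hbound hsm htm
    rw [Real.norm_eq_abs, Real.norm_eq_abs, abs_of_pos h0, ← Finset.sum_sub_distrib] at this
    refine this.trans (le_of_eq ?_)
    field_simp
  have hhigh : |∑ k ∈ S with ¬(0 < lam k ∧ lam k * h < 1),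
      (lam k ^ 2 * y k t ^ 2 - lam k ^ 2 * y k s ^ 2)| ≤ 2 * R * ωd h := by
    refine (Finset.abs_sum_le_sum_abs _ _).trans ?_
    have h1 := hpart (S.filter fun k => ¬(0 < lam k ∧ lam k * h < 1)) s hsm
    have h2 := hpart (S.filter fun k => ¬(0 < lam k ∧ lam k * h < 1)) t htm
    have h3 : ∑ k ∈ S with ¬(0 < lam k ∧ lam k * h < 1),
        |lam k ^ 2 * y k t ^ 2 - lam k ^ 2 * y k s ^ 2| ≤
        ∑ k ∈ S with ¬(0 < lam k ∧ lam k * h < 1),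
        ωd h * (Vsum lam ωd (fun k => y k t) (fun k => z k t) k +
          Vsum lam ωd (fun k => y k s) (fun k => z k s) k) := by
      refine Finset.sum_le_sum fun k hk => ?_
      have hk' := (Finset.mem_filter.1 hk).2
      rcases (hlam k).eq_or_lt with hk0 | hk0
      · simp [Vsum, ← hk0]
      have hk1 : 1 ≤ lam k * h := by
        by_contra hcon
        exact hk' ⟨hk0, not_le.1 hcon⟩
      have hw := hω.2.2.1 _ (one_div_pos.2 hk0)
      have hle : ωd (1 / lam k) ≤ ωd h :=
        hω.2.2.2.1 _ _ (by positivity) (by rw [div_le_iff₀ hk0]; linarith)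
      have hge : 1 ≤ ωd h / ωd (1 / lam k) := by rwa [one_le_div hw]
      have e : ∀ a b : ℝ, ωd h * (a / ωd (1 / lam k) + b / ωd (1 / lam k)) =
        ωd h / ωd (1 / lam k) * (a + b) := fun a b => by ring
      rw [Vsum, Vsum, if_pos hk0, if_pos hk0, e]
      refine le_trans ?_ (le_mul_of_one_le_left (by positivity) hge)
      rw [abs_le]
      constructor <;> nlinarith [sq_nonneg (z k t), sq_nonneg (z k s),
        sq_nonneg (lam k * y k t), sq_nonneg (lam k * y k s)]
    refine h3.trans ?_
    rw [← Finset.mul_sum, Finset.sum_add_distrib]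
    nlinarith
  linarith

/-- Functions with values in `[μ, M]` whose increments are controlled by `ω`. -/
structure IsAdmissible (μ M : ℝ) (ω c : ℝ → ℝ) : Prop where
  lb : ∀ t, μ ≤ c t
  ub : ∀ t, c t ≤ M
  osc : ∀ s t, |c s - c t| ≤ ω |s - t|

theorem IsAdmissible.continuous {μ M : ℝ} {ω c : ℝ → ℝ} (hω : Tendsto ω (𝓝[≥] 0) (𝓝 0))
    (h : IsAdmissible μ M ω c) : Continuous c := by
  refine continuous_iff_continuousAt.2 fun t => ?_
  rw [ContinuousAt, tendsto_iff_dist_tendsto_zero]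
  have h1 : Tendsto (fun s => |s - t|) (𝓝 t) (𝓝[≥] 0) := by
    refine tendsto_nhdsWithin_iff.2 ⟨?_, Eventually.of_forall fun s => mem_Ici.2 (abs_nonneg _)⟩
    have : Continuous fun s => |s - t| := by fun_prop
    simpa using this.tendsto t
  exact squeeze_zero (fun _ => dist_nonneg) (fun s => h.osc s t) (hω.comp h1)

theorem IsAdmissible.exists_ultrafilter_limit {μ M : ℝ} {ω : ℝ → ℝ} (U : Ultrafilter ℕ)
    {c : ℕ → ℝ → ℝ} (h : ∀ n, IsAdmissible μ M ω (c n)) :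
    ∃ c', IsAdmissible μ M ω c' ∧ ∀ t, Tendsto (fun n => c n t) U (𝓝 (c' t)) := by
  have hex : ∀ t, ∃ x, Tendsto (fun n => c n t) U (𝓝 x) := by
    intro t
    obtain ⟨x, -, hx⟩ := (isCompact_Icc (a := μ) (b := M)).ultrafilter_le_nhds
      (U.map fun n => c n t) (by
        rw [Ultrafilter.coe_map, le_principal_iff, Filter.mem_map]
        exact Filter.Eventually.of_forall fun n : ℕ => ⟨(h n).lb t, (h n).ub t⟩)
    exact ⟨x, hx⟩
  choose c' hlim using hex
  exact ⟨c', ⟨fun t => ge_of_tendsto' (hlim t) fun n : ℕ => (h n).lb t,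
    fun t => le_of_tendsto' (hlim t) fun n : ℕ => (h n).ub t,
    fun s t => le_of_tendsto' ((hlim s).sub (hlim t)).abs fun n : ℕ => (h n).osc s t⟩, hlim⟩

/-- Pointwise convergence of equicontinuous functions is uniform on compact sets. -/
theorem IsAdmissible.eventually_forall_abs_sub_lt {μ M : ℝ} {ω : ℝ → ℝ}
    (hω : Tendsto ω (𝓝[≥] 0) (𝓝 0)) {l : Filter ℕ} {c : ℕ → ℝ → ℝ} {c' : ℝ → ℝ}
    (h : ∀ n, IsAdmissible μ M ω (c n)) (h' : IsAdmissible μ M ω c')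
    (hlim : ∀ t, Tendsto (fun n => c n t) l (𝓝 (c' t))) {K : Set ℝ} (hK : IsCompact K)
    {ε : ℝ} (hε : 0 < ε) : ∀ᶠ n in l, ∀ t ∈ K, |c n t - c' t| < ε := by
  have hloc : TendstoLocallyUniformlyOn c c' l K := by
    rw [Metric.tendstoLocallyUniformlyOn_iff]
    intro r hr t _
    have h1 : ∀ᶠ x in 𝓝[≥] (0:ℝ), ω x < r / 3 := hω (Iio_mem_nhds (by positivity))
    obtain ⟨η, hη, hη'⟩ := Metric.mem_nhdsWithin_iff.1 h1
    refine ⟨Metric.ball t η, mem_nhdsWithin_of_mem_nhds (Metric.ball_mem_nhds t hη), ?_⟩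
    filter_upwards [Metric.tendsto_nhds.1 (hlim t) (r / 3) (by positivity)] with n hn s hs
    have h2 : ω |s - t| < r / 3 := hη' ⟨by simpa [Real.dist_eq] using hs, mem_Ici.2 (abs_nonneg _)⟩
    have h3 := abs_le.1 ((h n).osc s t)
    have h4 := abs_le.1 (h'.osc s t)
    rw [Real.dist_eq] at hn ⊢
    have h5 := abs_lt.1 hn
    rw [abs_lt]
    constructor <;> linarith
  have := (tendstoLocallyUniformlyOn_iff_tendstoUniformlyOn_of_compact hK).1 hloc
  filter_upwards [Metric.tendstoUniformlyOn_iff.1 this ε hε] with n hn t ht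
  rw [abs_sub_comm]
  exact hn t ht

/-- Time change that is the identity on `[0, T]` and lags behind by at most `h` later on. -/
def delay (T h t : ℝ) : ℝ := max 0 (max (min t T) (t - h))

theorem delay_nonneg (T h t : ℝ) : 0 ≤ delay T h t := le_max_left _ _

theorem abs_delay_sub_le (T h s t : ℝ) : |delay T h s - delay T h t| ≤ |s - t| := by
  unfold delay
  refine (abs_max_sub_max_le_max _ _ _ _).trans (max_le (by simp) ?_)
  refine (abs_max_sub_max_le_max _ _ _ _).trans (max_le ?_ (by simp))
  refine (abs_min_sub_min_le_max _ _ _ _).trans (max_le le_rfl (by simp))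

theorem delay_le {T h t : ℝ} (ht : 0 ≤ t) (hh : 0 ≤ h) : delay T h t ≤ t :=
  max_le ht (max_le (min_le_left _ _) (by linarith))

theorem delay_le_max {T h t : ℝ} (hT : 0 ≤ T) : delay T h t ≤ max T (t - h) :=
  max_le (hT.trans (le_max_left _ _)) (max_le_max (min_le_right _ _) le_rfl)

theorem delay_of_le {T h t : ℝ} (ht : 0 ≤ t) (htT : t ≤ T) (hh : 0 ≤ h) : delay T h t = t := by
  rw [delay, min_eq_left htT, max_eq_left (by linarith : t - h ≤ t), max_eq_right ht]

theorem delay_of_mem {T h t : ℝ} (hT : 0 ≤ T) (htT : T ≤ t) (hth : t ≤ T + h) :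
    delay T h t = T := by
  rw [delay, min_eq_right htT, max_eq_left (by linarith : t - h ≤ T), max_eq_right hT]

theorem le_delay_add {T h t : ℝ} : t - h ≤ delay T h t :=
  (le_max_right _ _).trans (le_max_right _ _)

/-- A causal, continuous self-map of a class of equicontinuous functions has a fixed point which
extends a prescribed fixed point on `[0, T]`. The proof uses Tonelli's delayed approximations. -/
theorem exists_causal_fixed_point {μ M T : ℝ} {ω : ℝ → ℝ} (hω : Tendsto ω (𝓝[≥] 0) (𝓝 0))
    (hωm : ∀ x y, 0 ≤ x → x ≤ y → ω x ≤ ω y) (G : (ℝ → ℝ) → ℝ → ℝ)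
    (hlb : ∀ c, IsAdmissible μ M ω c → ∀ t, 0 ≤ t → μ ≤ G c t)
    (hub : ∀ c, IsAdmissible μ M ω c → ∀ t, 0 ≤ t → G c t ≤ M)
    (hosc : ∀ c, IsAdmissible μ M ω c → ∀ s t, 0 ≤ s → 0 ≤ t → |G c s - G c t| ≤ ω |s - t|)
    (hcausal : ∀ c c', IsAdmissible μ M ω c → IsAdmissible μ M ω c' → ∀ s,
      (∀ t ∈ Icc 0 s, c t = c' t) → ∀ t ∈ Icc 0 s, G c t = G c' t)
    (hcont : ∀ (l : Filter ℕ) (c : ℕ → ℝ → ℝ) (c' : ℝ → ℝ), (∀ n, IsAdmissible μ M ω (c n)) →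
      IsAdmissible μ M ω c' → (∀ t, Tendsto (fun n => c n t) l (𝓝 (c' t))) →
      ∀ t, 0 ≤ t → Tendsto (fun n => G (c n) t) l (𝓝 (G c' t)))
    (hT : 0 ≤ T) {c₀ : ℝ → ℝ} (hc₀ : IsAdmissible μ M ω c₀)
    (hfix : ∀ t ∈ Icc 0 T, G c₀ t = c₀ t) (hconst : ∀ t, T ≤ t → c₀ t = c₀ T) :
    ∃ c, IsAdmissible μ M ω c ∧ (∀ t ∈ Icc 0 T, c t = c₀ t) ∧ ∀ t, 0 ≤ t → c t = G c t := by
  let Φ : ℝ → (ℝ → ℝ) → ℝ → ℝ := fun h c t => G c (delay T h t)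
  have hΦ : ∀ h c, IsAdmissible μ M ω c → IsAdmissible μ M ω (Φ h c) := fun h c hc =>
    ⟨fun t => hlb c hc _ (delay_nonneg _ _ _), fun t => hub c hc _ (delay_nonneg _ _ _),
      fun s t => (hosc c hc _ _ (delay_nonneg _ _ _) (delay_nonneg _ _ _)).trans
        (hωm _ _ (abs_nonneg _) (abs_delay_sub_le _ _ _ _))⟩
  have hit : ∀ h j, IsAdmissible μ M ω ((Φ h)^[j] c₀) := by
    intro h j
    induction j with
    | zero => exact hc₀
    | succ j ih => rw [Function.iterate_succ_apply']; exact hΦ h _ ih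
  have hstep : ∀ h, 0 < h → ∀ j : ℕ, ∀ t ∈ Icc 0 (T + (j + 1) * h),
      (Φ h)^[j + 1] c₀ t = (Φ h)^[j] c₀ t := by
    intro h hh j
    induction j with
    | zero =>
      intro t ht
      simp only [Nat.cast_zero, zero_add, one_mul] at ht
      change G c₀ (delay T h t) = c₀ t
      rcases le_total t T with htT | htT
      · rw [delay_of_le ht.1 htT hh.le, hfix t ⟨ht.1, htT⟩]
      · rw [delay_of_mem hT htT ht.2, hfix T ⟨hT, le_rfl⟩, hconst t htT]
    | succ j ih =>
      intro t ht
      rw [Function.iterate_succ_apply' (Φ h) (j + 1), Function.iterate_succ_apply' (Φ h) j]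
      have h1 : 0 ≤ (j + 1 : ℝ) * h := by positivity
      push_cast at ht
      refine hcausal _ _ ?_ (hit h j) _ ?_ (delay T h t)
        ⟨delay_nonneg _ _ _, (delay_le_max hT).trans
          (max_le (by linarith : T ≤ T + (j + 1) * h) (by linarith [ht.2]))⟩
      · rw [← Function.iterate_succ_apply' (Φ h) j]
        exact hit h (j + 1)
      · intro τ hτ
        rw [← Function.iterate_succ_apply' (Φ h) j]
        exact ih τ hτ
  have hinit : ∀ h, 0 < h → ∀ j : ℕ, ∀ t ∈ Icc 0 T, (Φ h)^[j] c₀ t = c₀ t := by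
    intro h hh j t ht
    induction j with
    | zero => rfl
    | succ j ih =>
      rw [hstep h hh j t ⟨ht.1, ht.2.trans (le_add_of_nonneg_right (by positivity))⟩, ih]
  let d : ℕ → ℝ := fun n => 1 / ((n : ℝ) + 1)
  have hd : ∀ n, 0 < d n := fun n => Nat.one_div_pos_of_nat
  have hd0 : Tendsto d atTop (𝓝 0) := tendsto_one_div_add_atTop_nhds_zero_nat
  let c : ℕ → ℝ → ℝ := fun n => (Φ (d n))^[(n + 1) ^ 2] c₀
  have hc : ∀ n, IsAdmissible μ M ω (c n) := fun n => hit _ _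
  have hcfix : ∀ n : ℕ, ∀ t ∈ Icc (0:ℝ) n, c n t = G (c n) (delay T (d n) t) := by
    intro n t ht
    refine (hstep (d n) (hd n) _ t ⟨ht.1, ht.2.trans ?_⟩).symm.trans ?_
    · have : ((n : ℝ) + 1) ^ 2 * d n = n + 1 := by simp only [d]; field_simp
      push_cast
      nlinarith [hd n]
    · rw [Function.iterate_succ_apply']
  let U : Ultrafilter ℕ := hyperfilter ℕ
  have hU : (U : Filter ℕ) ≤ atTop := Nat.hyperfilter_le_atTop
  obtain ⟨c', hc', hlim⟩ := IsAdmissible.exists_ultrafilter_limit U hc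
  refine ⟨c', hc', fun t ht => ?_, fun t ht => ?_⟩
  · exact tendsto_nhds_unique (hlim t)
      (tendsto_const_nhds.congr fun n => (hinit (d n) (hd n) _ t ht).symm)
  · have h1 : Tendsto (fun n => G (c n) t) U (𝓝 (G c' t)) := hcont U c c' hc hc' hlim t ht
    have h2 : Tendsto (fun n => |t - delay T (d n) t|) U (𝓝[≥] 0) := by
      refine tendsto_nhdsWithin_iff.2 ⟨?_, Eventually.of_forall fun s => mem_Ici.2 (abs_nonneg _)⟩
      refine squeeze_zero (fun _ => abs_nonneg _) (fun n => ?_) (hd0.mono_left hU)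
      rw [abs_of_nonneg (sub_nonneg.2 (delay_le ht (hd n).le))]
      linarith [le_delay_add (T := T) (h := d n) (t := t)]
    have h3 : Tendsto (fun n => G (c n) t - G (c n) (delay T (d n) t)) U (𝓝 0) :=
      squeeze_zero_norm (fun n => hosc _ (hc n) _ _ ht (delay_nonneg _ _ _)) (hω.comp h2)
    have h4 : Tendsto (fun n => G (c n) (delay T (d n) t)) U (𝓝 (G c' t)) := by
      simpa using h1.sub h3
    refine tendsto_nhds_unique (hlim t) (h4.congr' ?_)
    obtain ⟨n₀, hn₀⟩ := exists_nat_ge t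
    filter_upwards [hU (eventually_ge_atTop n₀)] with n hn
    exact (hcfix n t ⟨ht, hn₀.trans (by exact_mod_cast hn)⟩).symm

theorem IsModulus.tendsto_zero {ω : ℝ → ℝ} (h : IsModulus ω) : Tendsto ω (𝓝[≥] 0) (𝓝 0) := by
  have := (h.1 0 (mem_Ici.2 le_rfl)).tendsto
  rwa [h.2.1] at this

/-- The compatibility condition between the modulus of the nonlinearity and the strength of the
dissipation, in the form used for the frequency-by-frequency estimate. -/
theorem exists_small_radius {ωm : ℝ → ℝ} (hωm : IsModulus ωm) {σ α η : ℝ} (hσ : σ ≤ 1 / 2)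
    (hα0 : 0 ≤ α)
    (hlimsup : ∃ C : ℝ, ∀ᶠ x in 𝓝[>] (0:ℝ), ωm x ^ (4 * α) / x ^ (1 - 2 * σ) ≤ C)
    (hη : 0 < η) :
    ∃ R > 0, R ≤ 1 ∧ ωm R ≤ η ∧
      ∀ l : ℝ, 1 ≤ l → ωm (R * (1 / l) ^ (4 * α)) ≤ η * l ^ (2 * σ - 1) := by
  have hsmall : ∀ᶠ R in 𝓝[>] (0:ℝ), ωm R ≤ η :=
    ((hωm.tendsto_zero.mono_left (nhdsWithin_mono _ Ioi_subset_Ici_self)).eventually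
      (Iic_mem_nhds hη))
  have hone : ∀ᶠ R in 𝓝[>] (0:ℝ), R ≤ 1 :=
    mem_nhdsWithin_of_mem_nhds (Iic_mem_nhds one_pos)
  have hpos : ∀ᶠ R in 𝓝[>] (0:ℝ), 0 < R := self_mem_nhdsWithin
  rcases hσ.eq_or_lt with hσ' | hσ'
  · obtain ⟨R, hR0, hR1, hR⟩ := (hpos.and (hone.and hsmall)).exists
    refine ⟨R, hR0, hR1, hR, fun l hl => ?_⟩
    rw [show 2 * σ - 1 = 0 by linarith, Real.rpow_zero, mul_one]
    refine le_trans (hωm.2.2.2.1 _ _ (by positivity) ?_) hR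
    refine mul_le_of_le_one_right hR0.le (Real.rpow_le_one (by positivity) ?_ (by positivity))
    rw [div_le_one (by linarith)]
    exact hl
  have hp : 0 < 1 - 2 * σ := by linarith
  set p := 1 - 2 * σ with hpdef
  obtain ⟨C, hC⟩ := hlimsup
  have hpow : ∀ r : ℝ, 0 < r → Tendsto (fun x : ℝ => x ^ r) (𝓝[>] 0) (𝓝 0) := by
    intro r hr
    have := (Real.continuousAt_rpow_const 0 r (Or.inr hr.le)).tendsto
    rw [Real.zero_rpow hr.ne'] at this
    exact this.mono_left nhdsWithin_le_nhds
  rcases hα0.eq_or_lt with hα | hα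
  · exfalso
    have h1 : ∀ᶠ x in 𝓝[>] (0:ℝ), 1 ≤ C * x ^ p := by
      filter_upwards [hC, hpos] with x hx hx0
      rwa [← hα, mul_zero, Real.rpow_zero, div_le_iff₀ (Real.rpow_pos_of_pos hx0 _)] at hx
    have := ge_of_tendsto ((hpow p hp).const_mul C) h1
    norm_num at this
  set q := 4 * α with hqdef
  have hq : 0 < q := by positivity
  have hbound : ∀ᶠ x in 𝓝[>] (0:ℝ), ωm x ≤ (max C 1) ^ (1 / q) * x ^ (p / q) := by
    filter_upwards [hC, hpos] with x hx hx0
    rw [div_le_iff₀ (Real.rpow_pos_of_pos hx0 _)] at hx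
    have h1 : ωm x ^ q ≤ max C 1 * x ^ p :=
      hx.trans (mul_le_mul_of_nonneg_right (le_max_left _ _) (by positivity))
    have h2 := Real.rpow_le_rpow (by have := hωm.nonneg hx0.le; positivity) h1
      (by positivity : 0 ≤ 1 / q)
    rwa [← Real.rpow_mul (hωm.nonneg hx0.le), mul_one_div_cancel hq.ne', Real.rpow_one,
      Real.mul_rpow (by positivity) (by positivity), ← Real.rpow_mul hx0.le, mul_one_div] at h2
  obtain ⟨r, hr, hr'⟩ := Metric.mem_nhdsWithin_iff.1 hbound
  have hlt : ∀ᶠ R in 𝓝[>] (0:ℝ), R < r := mem_nhdsWithin_of_mem_nhds (Iio_mem_nhds hr)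
  have hlast : ∀ᶠ R in 𝓝[>] (0:ℝ), (max C 1) ^ (1 / q) * R ^ (p / q) ≤ η := by
    have := (hpow (p / q) (by positivity)).const_mul ((max C 1) ^ (1 / q))
    rw [mul_zero] at this
    exact this.eventually (Iic_mem_nhds hη)
  obtain ⟨R, hR0, hR1, hR, hRr, hRη⟩ := (hpos.and (hone.and (hsmall.and (hlt.and hlast)))).exists
  refine ⟨R, hR0, hR1, hR, fun l hl => ?_⟩
  have hl0 : 0 < l := by linarith
  have hx0 : 0 < R * (1 / l) ^ q := by positivity
  have hxR : R * (1 / l) ^ q ≤ R :=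
    mul_le_of_le_one_right hR0.le (Real.rpow_le_one (by positivity)
      (by rw [div_le_one hl0]; exact hl) hq.le)
  have h1 : ωm (R * (1 / l) ^ q) ≤ (max C 1) ^ (1 / q) * (R * (1 / l) ^ q) ^ (p / q) :=
    hr' ⟨by rw [Metric.mem_ball, Real.dist_eq, sub_zero, abs_of_pos hx0]; linarith, hx0⟩
  have h2 : (R * (1 / l) ^ q) ^ (p / q) = R ^ (p / q) * l ^ (-p) := by
    rw [Real.mul_rpow hR0.le (by positivity), ← Real.rpow_mul (by positivity),
      mul_div_cancel₀ _ hq.ne', one_div, Real.inv_rpow hl0.le, ← Real.rpow_neg hl0.le]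
  rw [h2, ← mul_assoc] at h1
  rw [show 2 * σ - 1 = -p by rw [hpdef]; ring]
  exact h1.trans (mul_le_mul_of_nonneg_right hRη (by positivity))

/-- Solutions on `J` of the decoupled linear problems
`y_k'' + 2δ λ_k^{2σ} y_k' + c(t) λ_k² y_k = 0` with initial data `(u0, u1)`. -/
structure IsModeFamily (lam : ℕ → ℝ) (σ δ : ℝ) (J : Set ℝ) (u0 u1 : ℕ → ℝ) (c : ℝ → ℝ)
    (y z : ℕ → ℝ → ℝ) : Prop where
  init_pos : ∀ k, y k 0 = u0 k
  init_vel : ∀ k, z k 0 = u1 k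
  osc : ∀ k, IsOscillatorOn J (2 * δ * lam k ^ (2 * σ)) (lam k ^ 2) c (y k) (z k)

theorem IsModeFamily.mono {lam : ℕ → ℝ} {σ δ : ℝ} {J J' : Set ℝ} {u0 u1 : ℕ → ℝ} {c : ℝ → ℝ}
    {y z : ℕ → ℝ → ℝ} (h : IsModeFamily lam σ δ J u0 u1 c y z) (hJ : J' ⊆ J) :
    IsModeFamily lam σ δ J' u0 u1 c y z :=
  ⟨h.init_pos, h.init_vel, fun k => (h.osc k).mono hJ⟩

theorem IsModeFamily.congr_coeff {lam : ℕ → ℝ} {σ δ : ℝ} {J : Set ℝ} {u0 u1 : ℕ → ℝ}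
    {c c' : ℝ → ℝ} {y z : ℕ → ℝ → ℝ} (h : IsModeFamily lam σ δ J u0 u1 c y z)
    (hc : ∀ t ∈ J, c t = c' t) : IsModeFamily lam σ δ J u0 u1 c' y z :=
  ⟨h.init_pos, h.init_vel, fun k => (h.osc k).congr_coeff hc⟩

theorem IsModeFamily.unique {lam : ℕ → ℝ} {σ δ s M : ℝ} {u0 u1 : ℕ → ℝ} {c : ℝ → ℝ}
    {y z y' z' : ℕ → ℝ → ℝ} (h : IsModeFamily lam σ δ (Icc 0 s) u0 u1 c y z)
    (h' : IsModeFamily lam σ δ (Icc 0 s) u0 u1 c y' z') (hM : ∀ t, |c t| ≤ M) (k : ℕ) :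
    ∀ t ∈ Icc 0 s, y k t = y' k t ∧ z k t = z' k t :=
  (h.osc k).unique (h'.osc k) ((h.init_pos k).trans (h'.init_pos k).symm)
    ((h.init_vel k).trans (h'.init_vel k).symm) fun t _ => hM t

theorem exists_isModeFamily (lam : ℕ → ℝ) (σ δ : ℝ) (u0 u1 : ℕ → ℝ) {c : ℝ → ℝ} {M : ℝ}
    (hc : Continuous c) (hM : ∀ t, |c t| ≤ M) :
    ∃ y z, IsModeFamily lam σ δ (Ici 0) u0 u1 c y z := by
  choose y z hy hz hyz using fun k => exists_isOscillatorOn_Ici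
    (2 * δ * lam k ^ (2 * σ)) (lam k ^ 2) hc hM (u0 k) (u1 k)
  exact ⟨y, z, hy, hz, hyz⟩

theorem IsOscillatorOn.tendsto {a b t M : ℝ} (ht : 0 ≤ t) {l : Filter ℕ}
    {c : ℕ → ℝ → ℝ} {c' : ℝ → ℝ} {y z : ℕ → ℝ → ℝ} {y' z' : ℝ → ℝ}
    (h : ∀ n, IsOscillatorOn (Icc 0 t) a b (c n) (y n) (z n))
    (h' : IsOscillatorOn (Icc 0 t) a b c' y' z')
    (hy : ∀ n, y n 0 = y' 0) (hz : ∀ n, z n 0 = z' 0) (hM : ∀ n s, |c n s| ≤ M)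
    (hlim : ∀ ε > 0, ∀ᶠ n in l, ∀ s ∈ Icc 0 t, |c n s - c' s| < ε) :
    Tendsto (fun n => y n t) l (𝓝 (y' t)) := by
  have hcont : ContinuousOn y' (Icc 0 t) := fun s hs => (h'.pos s hs).continuousWithinAt
  obtain ⟨B, hB⟩ := isCompact_Icc.exists_bound_of_continuousOn hcont
  have hB0 : 0 ≤ B := (norm_nonneg _).trans (hB 0 (left_mem_Icc.2 ht))
  rw [Metric.tendsto_nhds]
  intro θ hθ
  set K : NNReal := (1 + |a| + |b| * M).toNNReal
  have hg : Continuous fun ε => gronwallBound 0 K (|b| * ε) t :=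
    (gronwallBound_continuous_ε 0 K t).comp (continuous_const.mul continuous_id)
  have hg0 : Tendsto (fun ε => gronwallBound 0 K (|b| * ε) t) (𝓝[>] 0) (𝓝 0) := by
    have := hg.tendsto 0
    rw [mul_zero, gronwallBound_ε0_δ0] at this
    exact this.mono_left nhdsWithin_le_nhds
  obtain ⟨ε, hεθ, hε⟩ := ((hg0.eventually (Iio_mem_nhds hθ)).and self_mem_nhdsWithin).exists
  have hε0 : 0 < ε := hε
  filter_upwards [hlim (ε / (B + 1)) (by positivity)] with n hn
  rw [Real.dist_eq]
  refine (((h n).abs_sub_le h' (hy n) (hz n) (fun s _ => hM n s) (ε := ε) ?_ t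
    (right_mem_Icc.2 ht)).1).trans_lt hεθ
  intro s hs
  rw [abs_sub_comm]
  calc |c n s - c' s| * |y' s| ≤ ε / (B + 1) * B :=
        mul_le_mul (hn s hs).le (hB s hs) (abs_nonneg _) (by positivity)
    _ ≤ ε / (B + 1) * (B + 1) := by gcongr; linarith
    _ = ε := by field_simp

/-- Curves staying in a ball of the interpolation space. -/
structure StaysSmall (lam : ℕ → ℝ) (ωd : ℝ → ℝ) (R : ℝ) (J : Set ℝ) (y z : ℕ → ℝ → ℝ) :
    Prop where
  deriv : ∀ k, ∀ t ∈ J, HasDerivWithinAt (y k) (z k t) J t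
  summable : ∀ t ∈ J, Summable fun k => lam k ^ 2 * y k t ^ 2
  le : ∀ t ∈ J, ∑' k, lam k ^ 2 * y k t ^ 2 ≤ R
  summable_weighted : ∀ t ∈ J, Summable (Vsum lam ωd (fun k => y k t) (fun k => z k t))
  weighted_le : ∀ t ∈ J, ∑' k, Vsum lam ωd (fun k => y k t) (fun k => z k t) k ≤ R

/-- The modulus of continuity inherited by the coefficient of the equation. -/
def coeffModulus (ωm ωd : ℝ → ℝ) (R x : ℝ) : ℝ := ωm (R * min 1 (ωd x))

theorem coeffModulus_mono {ωm ωd : ℝ → ℝ} (hωm : IsModulus ωm) (hωd : IsModulus ωd) {R : ℝ}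
    (hR : 0 ≤ R) (x y : ℝ) (hx : 0 ≤ x) (hxy : x ≤ y) :
    coeffModulus ωm ωd R x ≤ coeffModulus ωm ωd R y := by
  have h0 : 0 ≤ min 1 (ωd x) := le_min zero_le_one (hωd.nonneg hx)
  exact hωm.2.2.2.1 _ _ (by positivity)
    (mul_le_mul_of_nonneg_left (min_le_min_left _ (hωd.2.2.2.1 x y hx hxy)) hR)

theorem tendsto_coeffModulus {ωm ωd : ℝ → ℝ} (hωm : IsModulus ωm) (hωd : IsModulus ωd) {R : ℝ}
    (hR : 0 ≤ R) : Tendsto (coeffModulus ωm ωd R) (𝓝[≥] 0) (𝓝 0) := by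
  refine hωm.tendsto_zero.comp (tendsto_nhdsWithin_iff.2 ⟨?_, ?_⟩)
  · have : Tendsto (fun x => R * min 1 (ωd x)) (𝓝[≥] 0) (𝓝 (R * min 1 0)) :=
      (tendsto_const_nhds.min hωd.tendsto_zero).const_mul R
    simpa using this
  · filter_upwards [self_mem_nhdsWithin] with x hx
    exact mul_nonneg hR (le_min zero_le_one (hωd.nonneg hx))

theorem StaysSmall.mono {lam : ℕ → ℝ} {ωd : ℝ → ℝ} {R : ℝ} {J J' : Set ℝ} {y z : ℕ → ℝ → ℝ}
    (h : StaysSmall lam ωd R J y z) (hJ : J' ⊆ J) : StaysSmall lam ωd R J' y z :=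
  ⟨fun k t ht => (h.deriv k t (hJ ht)).mono hJ, fun t ht => h.summable t (hJ ht),
    fun t ht => h.le t (hJ ht), fun t ht => h.summable_weighted t (hJ ht),
    fun t ht => h.weighted_le t (hJ ht)⟩

theorem StaysSmall.abs_nonlinearity_sub_le {lam : ℕ → ℝ} (hlam : ∀ k, 0 ≤ lam k)
    {m ωm ωd : ℝ → ℝ} (hωm : IsModulus ωm) (hωd : IsModulus ωd)
    (hmc : ∀ a b : ℝ, 0 ≤ a → 0 ≤ b → |m a - m b| ≤ ωm |a - b|) {R : ℝ} (hR : 0 ≤ R)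
    {J : Set ℝ} [hJ : J.OrdConnected] {y z : ℕ → ℝ → ℝ} (h : StaysSmall lam ωd R J y z) :
    ∀ s ∈ J, ∀ t ∈ J, |m (∑' k, lam k ^ 2 * y k s ^ 2) - m (∑' k, lam k ^ 2 * y k t ^ 2)| ≤
      coeffModulus ωm ωd (3 * R) |s - t| := by
  have hnn : ∀ t, 0 ≤ ∑' k, lam k ^ 2 * y k t ^ 2 := fun t =>
    tsum_nonneg fun k => by positivity
  intro s hs t ht
  wlog hst : s ≤ t generalizing s t
  · rw [abs_sub_comm, abs_sub_comm s]
    exact this t ht s hs (not_le.1 hst).le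
  refine (hmc _ _ (hnn s) (hnn t)).trans (hωm.2.2.2.1 _ _ (abs_nonneg _) ?_)
  have hsub : Icc s t ⊆ J := hJ.out hs ht
  have h' := h.mono hsub
  have h1 := abs_tsum_sub_le_modulus hlam hωd hst h'.deriv h'.summable_weighted h'.weighted_le
    (h.summable s hs) (h.summable t ht)
  rw [abs_sub_comm s, abs_of_nonneg (sub_nonneg.2 hst), abs_sub_comm]
  rcases le_total 1 (ωd (t - s)) with h2 | h2
  · rw [min_eq_left h2, abs_le]
    have := hnn s
    have := hnn t
    have := h.le s hs
    have := h.le t ht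
    constructor <;> linarith
  · rwa [min_eq_right h2]

theorem StaysSmall.isAdmissible {lam : ℕ → ℝ} (hlam : ∀ k, 0 ≤ lam k)
    {m ωm ωd : ℝ → ℝ} (hωm : IsModulus ωm) (hωd : IsModulus ωd)
    (hmc : ∀ a b : ℝ, 0 ≤ a → 0 ≤ b → |m a - m b| ≤ ωm |a - b|) {R μ M : ℝ} (hR : 0 ≤ R)
    (hlb : ∀ x, 0 ≤ x → μ ≤ m x) (hub : ∀ x, 0 ≤ x → x ≤ R → m x ≤ M)
    {T : ℝ} (hT : 0 ≤ T) {y z : ℕ → ℝ → ℝ} (h : StaysSmall lam ωd R (Icc 0 T) y z) :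
    IsAdmissible μ M (coeffModulus ωm ωd (3 * R))
      (fun t => m (∑' k, lam k ^ 2 * y k (max 0 (min T t)) ^ 2)) := by
  have hmem : ∀ t, max 0 (min T t) ∈ Icc 0 T := fun t =>
    ⟨le_max_left _ _, max_le hT (min_le_left _ _)⟩
  have hnn : ∀ t, 0 ≤ ∑' k, lam k ^ 2 * y k t ^ 2 := fun t =>
    tsum_nonneg fun k => by positivity
  refine ⟨fun t => hlb _ (hnn _), fun t => hub _ (hnn _) (h.le _ (hmem t)), fun s t => ?_⟩
  refine (h.abs_nonlinearity_sub_le hlam hωm hωd hmc hR _ (hmem s) _ (hmem t)).trans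
    (coeffModulus_mono hωm hωd (by positivity) _ _ (abs_nonneg _) ?_)
  refine (abs_max_sub_max_le_max _ _ _ _).trans (max_le (by simp) ?_)
  exact (abs_min_sub_min_le_max _ _ _ _).trans (max_le (by simp) le_rfl)

/-- The sum of the squared norms which is required to be small at the initial time. -/
def totalEnergy (lam : ℕ → ℝ) (ωd : ℝ → ℝ) (y z : ℕ → ℝ) : ℝ :=
  (∑' k, z k ^ 2) + (∑' k, lam k ^ 2 * y k ^ 2) + (∑' k, Vsum lam ωd y z k)

theorem totalEnergy_nonneg {lam : ℕ → ℝ} {ωd : ℝ → ℝ} (hωd : IsModulus ωd) (y z : ℕ → ℝ) :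
    0 ≤ totalEnergy lam ωd y z :=
  add_nonneg (add_nonneg (tsum_nonneg fun _ => by positivity)
    (tsum_nonneg fun _ => by positivity)) (tsum_nonneg (Vsum_nonneg hωd y z))

theorem tsum_le_totalEnergy {lam : ℕ → ℝ} {ωd : ℝ → ℝ} (hωd : IsModulus ωd) (y z : ℕ → ℝ) :
    (∑' k, lam k ^ 2 * y k ^ 2) ≤ totalEnergy lam ωd y z ∧
      (∑' k, Vsum lam ωd y z k) ≤ totalEnergy lam ωd y z := by
  have h1 : 0 ≤ ∑' k, z k ^ 2 := tsum_nonneg fun _ => by positivity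
  have h2 : 0 ≤ ∑' k, lam k ^ 2 * y k ^ 2 := tsum_nonneg fun _ => by positivity
  have h3 : 0 ≤ ∑' k, Vsum lam ωd y z k := tsum_nonneg (Vsum_nonneg hωd y z)
  unfold totalEnergy
  constructor <;> linarith

/-- Componentwise energy bounds give bounds for the norms. -/
theorem sums_le_of_energy_le {lam : ℕ → ℝ} {ωd : ℝ → ℝ} (hωd : IsModulus ωd)
    {u0 u1 y z : ℕ → ℝ} (hu : MemV lam ωd u0 u1) {C : ℝ}
    (h : ∀ k, z k ^ 2 + lam k ^ 2 * y k ^ 2 ≤ C * (u1 k ^ 2 + lam k ^ 2 * u0 k ^ 2)) :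
    (Summable fun k => lam k ^ 2 * y k ^ 2) ∧ (Summable fun k => z k ^ 2) ∧
    Summable (Vsum lam ωd y z) ∧
    totalEnergy lam ωd y z ≤ C * totalEnergy lam ωd u0 u1 := by
  obtain ⟨-, h0, h1, hV⟩ := hu
  have hE : Summable fun k => C * (u1 k ^ 2 + lam k ^ 2 * u0 k ^ 2) := (h1.add h0).mul_left C
  have hy : Summable fun k => lam k ^ 2 * y k ^ 2 :=
    hE.of_nonneg_of_le (fun k => by positivity) fun k => by nlinarith [h k, sq_nonneg (z k)]
  have hz : Summable fun k => z k ^ 2 :=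
    hE.of_nonneg_of_le (fun k => by positivity) fun k => by
      nlinarith [h k, mul_nonneg (sq_nonneg (lam k)) (sq_nonneg (y k))]
  have hle : ∀ k, Vsum lam ωd y z k ≤ C * Vsum lam ωd u0 u1 k := by
    intro k
    unfold Vsum
    split_ifs with hk
    · have := hωd.2.2.1 _ (one_div_pos.2 hk)
      rw [← mul_div_assoc]
      gcongr
      exact h k
    · simp
  have hVs : Summable (Vsum lam ωd y z) :=
    (hV.mul_left C).of_nonneg_of_le (Vsum_nonneg hωd y z) hle
  refine ⟨hy, hz, hVs, ?_⟩
  rw [totalEnergy, totalEnergy, ← hz.tsum_add hy, ← h1.tsum_add h0, mul_add, ← tsum_mul_left, ← tsum_mul_left]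
  exact add_le_add ((hz.add hy).tsum_le_tsum h hE) (hVs.tsum_le_tsum hle (hV.mul_left C))

theorem IsModeFamily.energy_le {lam : ℕ → ℝ} (hlam : ∀ k, 0 ≤ lam k) {ωm ωd : ℝ → ℝ}
    (hωm : IsModulus ωm) (hωd : IsModulus ωd) {σ δ α μ M η R : ℝ} (hσ0 : 0 < σ)
    (hσ : σ ≤ 1 / 2) (hδ : 0 < δ) (hμ : 0 < μ) (hη : η ≤ δ * μ) (hη2 : η ^ 2 ≤ 2 * μ * δ ^ 2)
    (hR0 : 0 ≤ R) (hR : ωm R ≤ η)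
    (hRl : ∀ l : ℝ, 1 ≤ l → ωm (R * (1 / l) ^ (4 * α)) ≤ η * l ^ (2 * σ - 1))
    (hωdα : ∀ x : ℝ, 0 ≤ x → ωd x ≤ x ^ (4 * α))
    {c : ℝ → ℝ} (hc : IsAdmissible μ M (coeffModulus ωm ωd R) c) {u0 u1 : ℕ → ℝ}
    {y z : ℕ → ℝ → ℝ} (h : IsModeFamily lam σ δ (Ici 0) u0 u1 c y z) (k : ℕ) :
    ∀ t, 0 ≤ t → z k t ^ 2 + lam k ^ 2 * y k t ^ 2 ≤
      (2 + 3 * δ ^ 2 + M) / min (1 / 2) μ * (u1 k ^ 2 + lam k ^ 2 * u0 k ^ 2) := by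
  have hnn : ∀ s t : ℝ, 0 ≤ min 1 (ωd |s - t|) := fun s t =>
    le_min zero_le_one (hωd.nonneg (abs_nonneg _))
  rw [← h.init_pos k, ← h.init_vel k]
  refine (h.osc k).energy_le_of_small_oscillation (hlam k) hσ0 hσ hδ
    (hc.continuous (tendsto_coeffModulus hωm hωd hR0)) hμ hc.lb hc.ub hη hη2 (fun s t => ?_) ?_
  · refine (hc.osc s t).trans ((hωm.2.2.2.1 _ _ (mul_nonneg hR0 (hnn s t)) ?_).trans hR)
    exact mul_le_of_le_one_right hR0 (min_le_left _ _)
  · intro hl s t hst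
    refine (hc.osc s t).trans ((hωm.2.2.2.1 _ _ (mul_nonneg hR0 (hnn s t)) ?_).trans (hRl _ hl))
    refine mul_le_mul_of_nonneg_left ((min_le_right _ _).trans ?_) hR0
    exact (hωd.2.2.2.1 _ _ (abs_nonneg _) hst).trans (hωdα _ (by positivity))

theorem IsAdmissible.abs_le {μ M : ℝ} {ω c : ℝ → ℝ} (hμ : 0 < μ) (h : IsAdmissible μ M ω c)
    (t : ℝ) : |c t| ≤ M :=
  _root_.abs_le.2 ⟨by linarith [h.lb t, h.ub t], h.ub t⟩

theorem StaysSmall.of_energy_le {lam : ℕ → ℝ} {ωd : ℝ → ℝ} (hωd : IsModulus ωd)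
    {u0 u1 : ℕ → ℝ} (hu : MemV lam ωd u0 u1) {C R : ℝ}
    (hN : C * totalEnergy lam ωd u0 u1 ≤ R) {J : Set ℝ} {y z : ℕ → ℝ → ℝ}
    (hder : ∀ k, ∀ t ∈ J, HasDerivWithinAt (y k) (z k t) J t)
    (h : ∀ k, ∀ t ∈ J, z k t ^ 2 + lam k ^ 2 * y k t ^ 2 ≤
      C * (u1 k ^ 2 + lam k ^ 2 * u0 k ^ 2)) : StaysSmall lam ωd R J y z := by
  have key := fun t ht => sums_le_of_energy_le hωd hu fun k => h k t ht
  have key' := fun t => tsum_le_totalEnergy (lam := lam) hωd (fun k => y k t) fun k => z k t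
  exact ⟨hder, fun t ht => (key t ht).1, fun t ht => (key' t).1.trans ((key t ht).2.2.2.trans hN),
    fun t ht => (key t ht).2.2.1, fun t ht => (key' t).2.trans ((key t ht).2.2.2.trans hN)⟩

/-- Continuation argument: the energy of a solution of the nonlinear problem stays below `R`. -/
theorem IsModeFamily.staysSmall {lam : ℕ → ℝ} (hlam : ∀ k, 0 ≤ lam k) {m ωm ωd : ℝ → ℝ}
    (hωm : IsModulus ωm) (hωd : IsModulus ωd)
    (hmc : ∀ a b : ℝ, 0 ≤ a → 0 ≤ b → |m a - m b| ≤ ωm |a - b|) {R μ M : ℝ} (hR : 0 ≤ R)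
    (hμ : 0 < μ) (hlb : ∀ x, 0 ≤ x → μ ≤ m x) (hub : ∀ x, 0 ≤ x → x ≤ R → m x ≤ M)
    {u0 u1 : ℕ → ℝ} (hu : MemV lam ωd u0 u1) {σ δ C : ℝ}
    (hE : ∀ c, IsAdmissible μ M (coeffModulus ωm ωd (3 * R)) c → ∀ y z,
      IsModeFamily lam σ δ (Ici 0) u0 u1 c y z → ∀ k t, 0 ≤ t →
        z k t ^ 2 + lam k ^ 2 * y k t ^ 2 ≤ C * (u1 k ^ 2 + lam k ^ 2 * u0 k ^ 2))
    (hN0 : totalEnergy lam ωd u0 u1 < R) (hN : C * totalEnergy lam ωd u0 u1 < R)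
    {T : ℝ} {y z : ℕ → ℝ → ℝ}
    (h : IsModeFamily lam σ δ (Icc 0 T) u0 u1 (fun t => m (∑' j, lam j ^ 2 * y j t ^ 2)) y z)
    (hys : ∀ t ∈ Icc 0 T, Summable fun k => lam k ^ 2 * y k t ^ 2)
    (hVs : ∀ t ∈ Icc 0 T, Summable (Vsum lam ωd (fun k => y k t) fun k => z k t))
    (hcont : ContinuousOn (fun t => totalEnergy lam ωd (fun k => y k t) fun k => z k t)
      (Icc 0 T)) : StaysSmall lam ωd R (Icc 0 T) y z := by
  set N : ℝ → ℝ := fun t => totalEnergy lam ωd (fun k => y k t) fun k => z k t with hNdef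
  have hN_zero : N 0 < R := by
    simpa only [hNdef, h.init_pos, h.init_vel] using hN0
  have hsmall : ∀ s, Icc 0 s ⊆ Icc 0 T → (∀ t ∈ Icc 0 s, N t ≤ R) →
      StaysSmall lam ωd R (Icc 0 s) y z := fun s hs hNs =>
    ⟨fun k => ((h.osc k).mono hs).pos, fun t ht => hys t (hs ht),
      fun t ht => (tsum_le_totalEnergy hωd _ _).1.trans (hNs t ht), fun t ht => hVs t (hs ht),
      fun t ht => (tsum_le_totalEnergy hωd _ _).2.trans (hNs t ht)⟩
  refine hsmall T Subset.rfl ?_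
  by_contra! hcon
  obtain ⟨t₂, ht₂, hNt₂⟩ := hcon
  have hclosed : IsClosed (Icc 0 T ∩ N ⁻¹' Ici R) :=
    hcont.preimage_isClosed_of_isClosed isClosed_Icc isClosed_Ici
  obtain ⟨t₁, ⟨ht₁, hNt₁⟩, hmin⟩ := (isCompact_Icc.of_isClosed_subset hclosed
    inter_subset_left).exists_isLeast ⟨t₂, ht₂, hNt₂.le⟩
  have hsub : Icc 0 t₁ ⊆ Icc 0 T := Icc_subset_Icc_right ht₁.2
  obtain ⟨t₃, ht₃, hNt₃⟩ := intermediate_value_Icc ht₁.1 (hcont.mono hsub) ⟨hN_zero.le, hNt₁⟩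
  have h31 : t₁ = t₃ := le_antisymm (hmin ⟨hsub ht₃, hNt₃.ge⟩) ht₃.2
  have hNle : ∀ t ∈ Icc 0 t₁, N t ≤ R := by
    intro t ht
    rcases ht.2.eq_or_lt with rfl | hlt
    · rw [h31, hNt₃]
    · exact le_of_not_ge fun hge => (hmin ⟨hsub ht, hge⟩).not_gt hlt
  have hadm := (hsmall t₁ hsub hNle).isAdmissible hlam hωm hωd hmc hR hlb hub ht₁.1
  have hcadm := hadm.continuous (tendsto_coeffModulus hωm hωd (by positivity))
  obtain ⟨Y, Z, hYZ⟩ := exists_isModeFamily lam σ δ u0 u1 hcadm (hadm.abs_le hμ)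
  have huniq := (hYZ.mono Icc_subset_Ici_self).unique ((h.mono hsub).congr_coeff fun t ht => by
    rw [min_eq_right ht.2, max_eq_right ht.1]) (hadm.abs_le hμ)
  have hlast : N t₁ ≤ C * totalEnergy lam ωd u0 u1 := by
    refine (sums_le_of_energy_le hωd hu fun k => ?_).2.2.2
    obtain ⟨h1, h2⟩ := huniq k t₁ (right_mem_Icc.2 ht₁.1)
    rw [← h1, ← h2]
    exact hE _ hadm Y Z hYZ k t₁ ht₁.1
  exact absurd (hlast.trans_lt hN) (not_lt.2 hNt₁)

/-- Global existence for the nonlinear system of modes, extending a given small solution. -/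
theorem exists_global_modes {lam : ℕ → ℝ} (hlam : ∀ k, 0 ≤ lam k) {m ωm ωd : ℝ → ℝ}
    (hωm : IsModulus ωm) (hωd : IsModulus ωd)
    (hmc : ∀ a b : ℝ, 0 ≤ a → 0 ≤ b → |m a - m b| ≤ ωm |a - b|) {R μ M : ℝ} (hR : 0 ≤ R)
    (hμ : 0 < μ) (hlb : ∀ x, 0 ≤ x → μ ≤ m x) (hub : ∀ x, 0 ≤ x → x ≤ R → m x ≤ M)
    {u0 u1 : ℕ → ℝ} (hu : MemV lam ωd u0 u1) {σ δ C : ℝ}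
    (hE : ∀ c, IsAdmissible μ M (coeffModulus ωm ωd (3 * R)) c → ∀ y z,
      IsModeFamily lam σ δ (Ici 0) u0 u1 c y z → ∀ k t, 0 ≤ t →
        z k t ^ 2 + lam k ^ 2 * y k t ^ 2 ≤ C * (u1 k ^ 2 + lam k ^ 2 * u0 k ^ 2))
    (hN : C * totalEnergy lam ωd u0 u1 ≤ R) {T : ℝ} (hT : 0 ≤ T) {y z : ℕ → ℝ → ℝ}
    (h : IsModeFamily lam σ δ (Icc 0 T) u0 u1 (fun t => m (∑' j, lam j ^ 2 * y j t ^ 2)) y z)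
    (hsmall : StaysSmall lam ωd R (Icc 0 T) y z) :
    ∃ Y Z c, Continuous c ∧ (∀ t, 0 ≤ t → c t = m (∑' j, lam j ^ 2 * Y j t ^ 2)) ∧
      IsModeFamily lam σ δ (Ici 0) u0 u1 c Y Z ∧
      (∀ k t, 0 ≤ t → Z k t ^ 2 + lam k ^ 2 * Y k t ^ 2 ≤
        C * (u1 k ^ 2 + lam k ^ 2 * u0 k ^ 2)) ∧
      ∀ k, ∀ t ∈ Icc 0 T, Y k t = y k t := by
  set ω := coeffModulus ωm ωd (3 * R)
  have hω : Tendsto ω (𝓝[≥] 0) (𝓝 0) := tendsto_coeffModulus hωm hωd (by positivity)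
  have hωmono := coeffModulus_mono hωm hωd (R := 3 * R) (by positivity)
  have hex : ∀ c, ∃ YZ : (ℕ → ℝ → ℝ) × (ℕ → ℝ → ℝ), IsAdmissible μ M ω c →
      IsModeFamily lam σ δ (Ici 0) u0 u1 c YZ.1 YZ.2 := by
    intro c
    by_cases hc : IsAdmissible μ M ω c
    · obtain ⟨Y, Z, hYZ⟩ := exists_isModeFamily lam σ δ u0 u1 (hc.continuous hω) (hc.abs_le hμ)
      exact ⟨(Y, Z), fun _ => hYZ⟩
    · exact ⟨(0, 0), fun h => absurd h hc⟩
  choose YZ hYZ using hex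
  have hst : ∀ c, IsAdmissible μ M ω c → StaysSmall lam ωd R (Ici 0) (YZ c).1 (YZ c).2 :=
    fun c hc => .of_energy_le hωd hu hN (fun k => ((hYZ c hc).osc k).pos)
      fun k t ht => hE c hc _ _ (hYZ c hc) k t ht
  let G : (ℝ → ℝ) → ℝ → ℝ := fun c t => m (∑' j, lam j ^ 2 * (YZ c).1 j t ^ 2)
  have hnn : ∀ (x : ℕ → ℝ), 0 ≤ ∑' k, lam k ^ 2 * x k ^ 2 := fun t =>
    tsum_nonneg fun k => by positivity
  have hcausal : ∀ c c', IsAdmissible μ M ω c → IsAdmissible μ M ω c' → ∀ s,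
      (∀ t ∈ Icc 0 s, c t = c' t) → ∀ k, ∀ t ∈ Icc 0 s, (YZ c).1 k t = (YZ c').1 k t := by
    intro c c' hc hc' s hcc' k t ht
    exact (((hYZ c hc).mono Icc_subset_Ici_self).unique
      (((hYZ c' hc').mono Icc_subset_Ici_self).congr_coeff fun τ hτ => (hcc' τ hτ).symm)
      (hc.abs_le hμ) k t ht).1
  have hc₀ := hsmall.isAdmissible hlam hωm hωd hmc hR hlb hub hT
  have hclamp : ∀ t ∈ Icc 0 T, max 0 (min T t) = t := fun t ht => by
    rw [min_eq_right ht.2, max_eq_right ht.1]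
  have hy : ∀ k, ∀ t ∈ Icc 0 T, (YZ _).1 k t = y k t := fun k t ht =>
    (((hYZ _ hc₀).mono Icc_subset_Ici_self).unique
      (h.congr_coeff fun τ hτ => by rw [hclamp τ hτ]) (hc₀.abs_le hμ) k t ht).1
  obtain ⟨c, hc, hcT, hcG⟩ := exists_causal_fixed_point hω hωmono G
    (fun c hc t ht => hlb _ (hnn _))
    (fun c hc t ht => hub _ (hnn _) ((hst c hc).le t ht))
    (fun c hc s t hs ht => (hst c hc).abs_nonlinearity_sub_le hlam hωm hωd hmc hR s hs t ht)
    (fun c c' hc hc' s hcc' t ht => by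
      simp only [G]
      congr 2
      ext k
      rw [hcausal c c' hc hc' s hcc' k t ht])
    (fun l c c' hc hc' hlim t ht => by
      have hmodes : ∀ k, Tendsto (fun n => (YZ (c n)).1 k t) l (𝓝 ((YZ c').1 k t)) := fun k =>
        IsOscillatorOn.tendsto ht
          (fun n => ((hYZ _ (hc n)).osc k).mono Icc_subset_Ici_self)
          (((hYZ c' hc').osc k).mono Icc_subset_Ici_self)
          (fun n => ((hYZ _ (hc n)).init_pos k).trans ((hYZ c' hc').init_pos k).symm)
          (fun n => ((hYZ _ (hc n)).init_vel k).trans ((hYZ c' hc').init_vel k).symm)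
          (fun n => (hc n).abs_le hμ)
          fun ε hε => IsAdmissible.eventually_forall_abs_sub_lt hω hc hc' hlim isCompact_Icc hε
      have hF : Tendsto (fun n => ∑' j, lam j ^ 2 * (YZ (c n)).1 j t ^ 2) l
          (𝓝 (∑' j, lam j ^ 2 * (YZ c').1 j t ^ 2)) := by
        refine tendsto_tsum_of_dominated_convergence ((hu.2.2.1.add hu.2.1).mul_left C)
          (fun k => ((hmodes k).pow 2).const_mul _) (Eventually.of_forall fun n k => ?_)
        rw [Real.norm_of_nonneg (by positivity)]
        linarith [hE _ (hc n) _ _ (hYZ _ (hc n)) k t ht, sq_nonneg ((YZ (c n)).2 k t)]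
      rw [tendsto_iff_dist_tendsto_zero] at hF ⊢
      refine squeeze_zero (fun _ => dist_nonneg) (fun n => hmc _ _ (hnn _) (hnn _))
        (hωm.tendsto_zero.comp (tendsto_nhdsWithin_iff.2
          ⟨hF, Eventually.of_forall fun n => mem_Ici.2 (abs_nonneg _)⟩)))
    hT hc₀
    (fun t ht => by
      simp only [G, hclamp t ht]
      congr 2
      ext k
      rw [hy k t ht])
    (fun t ht => by rw [min_eq_left ht, min_self])
  refine ⟨(YZ c).1, (YZ c).2, c, hc.continuous hω, hcG, hYZ c hc,
    hE c hc _ _ (hYZ c hc), fun k t ht => ?_⟩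
  rw [← hy k t ht]
  exact hcausal c _ hc hc₀ T hcT k t ht

theorem IsKirchhoffSol.isModeFamily {lam : ℕ → ℝ} {m : ℝ → ℝ} {σ δ T : ℝ} (hT : 0 < T)
    {u0 u1 : ℕ → ℝ} {u : ℕ → ℝ → ℝ} (h : IsKirchhoffSol lam m σ δ (Icc 0 T) u0 u1 u) :
    IsModeFamily lam σ δ (Icc 0 T) u0 u1 (fun t => m (∑' j, lam j ^ 2 * u j t ^ 2)) u
      (fun k => derivWithin (u k) (Icc 0 T)) := by
  obtain ⟨hC, hu0, hu1, hode, -⟩ := h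
  have hC' := fun k => (contDiffOn_succ_iff_derivWithin (n := 1) (uniqueDiffOn_Icc hT)).1
    (by simpa [one_add_one_eq_two] using hC k)
  refine ⟨hu0, hu1, fun k => ⟨fun t ht => ((hC' k).1 t ht).hasDerivWithinAt, fun t ht => ?_⟩⟩
  have h1 := (((hC' k).2.2.differentiableOn one_ne_zero) t ht).hasDerivWithinAt
  refine h1.congr_deriv ?_
  linarith [hode k t ht]

theorem Vsum_eq_add_sq {lam : ℕ → ℝ} {ωd : ℝ → ℝ} (hωd : IsModulus ωd) (y z : ℕ → ℝ) (k : ℕ) :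
    Vsum lam ωd y z k =
      (if 0 < lam k then lam k * y k / Real.sqrt (ωd (1 / lam k)) else 0) ^ 2 +
      (if 0 < lam k then z k / Real.sqrt (ωd (1 / lam k)) else 0) ^ 2 := by
  unfold Vsum
  split_ifs with hk
  · rw [div_pow, div_pow, Real.sq_sqrt (hωd.nonneg (by positivity))]
    ring
  · simp

theorem continuousOn_totalEnergy {lam : ℕ → ℝ} {m ωd : ℝ → ℝ} (hωd : IsModulus ωd) {σ δ : ℝ}
    {I : Set ℝ} {u0 u1 : ℕ → ℝ} {u : ℕ → ℝ → ℝ} (h : IsKirchhoffSol lam m σ δ I u0 u1 u)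
    (hV : VRegCurves lam ωd I u) :
    ContinuousOn (fun t => totalEnergy lam ωd (fun k => u k t) fun k => derivWithin (u k) I t)
      I := by
  obtain ⟨-, -, -, -, -, hy, hz⟩ := h
  obtain ⟨-, hVy, hVz⟩ := hV
  refine (hz.continuousOn_tsum_sq.add ?_).add ?_
  · simpa only [mul_pow] using hy.continuousOn_tsum_sq
  · refine (hVy.continuousOn_tsum_sq.add hVz.continuousOn_tsum_sq).congr fun t ht => ?_
    simp only [Vsum_eq_add_sq hωd]
    exact (hVy.1 t ht).tsum_add (hVz.1 t ht)

theorem isKirchhoffSol_of_isModeFamily {lam : ℕ → ℝ} {m ωd : ℝ → ℝ} (hωd : IsModulus ωd)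
    {σ δ C : ℝ} {u0 u1 : ℕ → ℝ} (hu : MemV lam ωd u0 u1) {c : ℝ → ℝ} (hc : Continuous c)
    {y z : ℕ → ℝ → ℝ} (hcm : ∀ t, 0 ≤ t → c t = m (∑' j, lam j ^ 2 * y j t ^ 2))
    (h : IsModeFamily lam σ δ (Ici 0) u0 u1 c y z)
    (hE : ∀ k t, 0 ≤ t → z k t ^ 2 + lam k ^ 2 * y k t ^ 2 ≤
      C * (u1 k ^ 2 + lam k ^ 2 * u0 k ^ 2)) :
    IsKirchhoffSol lam m σ δ (Ici 0) u0 u1 y ∧ VRegCurves lam ωd (Ici 0) y := by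
  have hD : UniqueDiffOn ℝ (Ici (0:ℝ)) := uniqueDiffOn_Ici 0
  have hd : ∀ k, ∀ t ∈ Ici (0:ℝ), derivWithin (y k) (Ici 0) t = z k t := fun k t ht =>
    ((h.osc k).pos t ht).derivWithin (hD t ht)
  have hd2 : ∀ k, ∀ t ∈ Ici (0:ℝ), derivWithin (derivWithin (y k) (Ici 0)) (Ici 0) t =
      -(2 * δ * lam k ^ (2 * σ) * z k t + lam k ^ 2 * c t * y k t) := fun k t ht => by
    rw [derivWithin_congr (hd k) (hd k t ht)]
    exact ((h.osc k).vel t ht).derivWithin (hD t ht)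
  have hyc : ∀ k, ContinuousOn (y k) (Ici 0) := fun k t ht =>
    ((h.osc k).pos t ht).continuousWithinAt
  have hzc : ∀ k, ContinuousOn (z k) (Ici 0) := fun k t ht =>
    ((h.osc k).vel t ht).continuousWithinAt
  have hdc : ∀ k, ContinuousOn (derivWithin (y k) (Ici 0)) (Ici 0) := fun k =>
    (hzc k).congr (hd k)
  have hmem : ∀ {t S : ℝ}, t ∈ Icc 0 S → t ∈ Ici (0:ℝ) := fun ht => ht.1
  have hEs : Summable fun k => C * (u1 k ^ 2 + lam k ^ 2 * u0 k ^ 2) :=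
    (hu.2.2.1.add hu.2.1).mul_left C
  have hVle : ∀ t ∈ Ici (0:ℝ), ∀ k,
      Vsum lam ωd (fun k => y k t) (fun k => derivWithin (y k) (Ici 0) t) k ≤
        C * Vsum lam ωd u0 u1 k := by
    intro t ht k
    unfold Vsum
    split_ifs with hk
    · have := hωd.2.2.1 _ (one_div_pos.2 hk)
      beta_reduce
      rw [hd k t ht, ← mul_div_assoc]
      gcongr
      exact hE k t ht
    · simp
  have hzle : ∀ k t, 0 ≤ t → z k t ^ 2 ≤ C * (u1 k ^ 2 + lam k ^ 2 * u0 k ^ 2) := fun k t ht => by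
    nlinarith [hE k t ht, mul_nonneg (sq_nonneg (lam k)) (sq_nonneg (y k t))]
  refine ⟨⟨fun k => ?_, h.init_pos, fun k => ?_, fun k t ht => ?_, ?_, ?_, ?_⟩, ?_, ?_, ?_⟩
  · have h1 : ContDiffOn ℝ 1 (derivWithin (y k) (Ici 0)) (Ici 0) := by
      refine (contDiffOn_one_iff_derivWithin hD).2 ⟨fun t ht => ?_, ?_⟩
      · exact (((h.osc k).vel t ht).congr (hd k) (hd k t ht)).differentiableWithinAt
      · refine ContinuousOn.congr ?_ (hd2 k)
        exact ((continuousOn_const.mul (hzc k)).add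
          ((continuousOn_const.mul hc.continuousOn).mul (hyc k))).neg
    have h2 := (contDiffOn_succ_iff_derivWithin (n := 1) (f := y k) hD).2
      ⟨fun t ht => ((h.osc k).pos t ht).differentiableWithinAt, by simp, h1⟩
    simpa [one_add_one_eq_two] using h2
  · rw [hd k 0 self_mem_Ici, h.init_vel k]
  · rw [hd2 k t ht, hd k t ht, ← hcm t ht]
    ring
  · refine .of_dominated hyc fun S => ⟨fun k => 2 * u0 k ^ 2 +
      2 * S ^ 2 * (C * (u1 k ^ 2 + lam k ^ 2 * u0 k ^ 2)),
      (hu.1.mul_left 2).add (hEs.mul_left _), fun t ht k => ?_⟩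
    set e := C * (u1 k ^ 2 + lam k ^ 2 * u0 k ^ 2)
    have he : 0 ≤ e := (sq_nonneg _).trans (hzle k 0 le_rfl)
    have h1 := (convex_Icc 0 t).norm_image_sub_le_of_norm_hasDerivWithin_le
      (C := Real.sqrt e) (fun s hs => ((h.osc k).mono Icc_subset_Ici_self).pos s hs)
      (fun s hs => Real.le_sqrt_of_sq_le (by
        rw [Real.norm_eq_abs, sq_abs]; exact hzle k s hs.1))
      (left_mem_Icc.2 ht.1) (right_mem_Icc.2 ht.1)
    rw [h.init_pos, sub_zero, Real.norm_eq_abs, Real.norm_eq_abs, abs_of_nonneg ht.1] at h1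
    have h2 : (y k t - u0 k) ^ 2 ≤ e * S ^ 2 := by
      rw [← sq_abs]
      refine (pow_le_pow_left₀ (abs_nonneg _) h1 2).trans ?_
      rw [mul_pow, Real.sq_sqrt he]
      exact mul_le_mul_of_nonneg_left (pow_le_pow_left₀ ht.1 ht.2 2) he
    nlinarith [sq_nonneg (y k t - 2 * u0 k)]
  · refine .of_dominated (fun k => continuousOn_const.mul (hyc k)) fun S =>
      ⟨_, hEs, fun t ht k => ?_⟩
    rw [mul_pow]
    linarith [hE k t ht.1, sq_nonneg (z k t)]
  · refine .of_dominated hdc fun S => ⟨_, hEs, fun t ht k => ?_⟩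
    rw [hd k t (hmem ht)]
    exact hzle k t ht.1
  · exact fun t ht => (hu.2.2.2.mul_left C).of_nonneg_of_le (Vsum_nonneg hωd _ _) (hVle t ht)
  · refine .of_dominated (fun k => ?_) fun S =>
      ⟨_, hu.2.2.2.mul_left C, fun t ht k => le_trans ?_ (hVle t (hmem ht) k)⟩
    · split_ifs
      · exact (continuousOn_const.mul (hyc k)).div_const _
      · exact continuousOn_const
    · rw [Vsum_eq_add_sq hωd]
      exact le_add_of_nonneg_right (sq_nonneg _)
  · refine .of_dominated (fun k => ?_) fun S =>
      ⟨_, hu.2.2.2.mul_left C, fun t ht k => le_trans ?_ (hVle t (hmem ht) k)⟩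
    · split_ifs
      · exact (hdc k).div_const _
      · exact continuousOn_const
    · rw [Vsum_eq_add_sq hωd]
      exact le_add_of_nonneg_left (sq_nonneg _)

/-- Subcritical dissipation: global existence for data which are small in
`V_{ωd}`, with a smallness threshold `ε₁` independent of the continuity modulus `ωd`
(among those compatible with `α`). -/
theorem global_existence_small_data_interpolation
    (lam : ℕ → ℝ) (hlam : ∀ k, 0 ≤ lam k)
    (μ₁ : ℝ) (hμ₁ : 0 < μ₁)
    (m : ℝ → ℝ) (hmlb : ∀ x : ℝ, 0 ≤ x → μ₁ ≤ m x)
    (ωm : ℝ → ℝ) (hωm : IsModulus ωm)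
    (hmc : ∀ a b : ℝ, 0 ≤ a → 0 ≤ b → |m a - m b| ≤ ωm |a - b|)
    (σ δ : ℝ) (hσ0 : 0 < σ) (hσ : σ ≤ 1 / 2) (hδ : 0 < δ)
    (α : ℝ) (hα0 : 0 ≤ α) (hα1 : α < 1 / 4)
    (hlimsup : ∃ C : ℝ, ∀ᶠ x in 𝓝[>] (0:ℝ), ωm x ^ (4 * α) / x ^ (1 - 2 * σ) ≤ C) :
    ∃ ε₁ > (0:ℝ),
      ∀ ωd : ℝ → ℝ, IsModulus ωd → ωd 1 = 1 →
        (∀ x : ℝ, 0 ≤ x → ωd x ≤ x ^ (4 * α)) →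
        Tendsto (fun x => ωd x / x ^ (4 * α)) (𝓝[>] (0:ℝ)) (𝓝 0) →
      ∀ u0 u1 : ℕ → ℝ, MemV lam ωd u0 u1 →
        (∑' k, u1 k ^ 2) + (∑' k, lam k ^ 2 * u0 k ^ 2) +
          (∑' k, Vsum lam ωd u0 u1 k) ≤ ε₁ →
      ∀ T : ℝ, 0 < T →
      ∀ u : ℕ → ℝ → ℝ, IsKirchhoffSol lam m σ δ (Icc 0 T) u0 u1 u →
        VRegCurves lam ωd (Icc 0 T) u →
        ∃ w : ℕ → ℝ → ℝ,
          IsKirchhoffSol lam m σ δ (Ici 0) u0 u1 w ∧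
          VRegCurves lam ωd (Ici 0) w ∧
          ∀ k, ∀ t ∈ Icc (0:ℝ) T, w k t = u k t := by
  obtain ⟨R', hR'0, hR'1, hR'η, hR'l⟩ := exists_small_radius hωm hσ hα0 hlimsup
    (lt_min (mul_pos hδ hμ₁) (mul_pos hδ (Real.sqrt_pos.2 (mul_pos two_pos hμ₁))))
  set η := min (δ * μ₁) (δ * Real.sqrt (2 * μ₁)) with hη
  have hη0 : 0 ≤ η := by positivity
  have hη2 : η ^ 2 ≤ 2 * μ₁ * δ ^ 2 := by
    refine (pow_le_pow_left₀ hη0 (min_le_right _ _) 2).trans (le_of_eq ?_)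
    rw [mul_pow, Real.sq_sqrt (by positivity)]
    ring
  set R := R' / 3 with hRdef
  have hR3 : 3 * R = R' := by rw [hRdef]; ring
  have hR : 0 < R := by positivity
  set M := m 0 + ωm 1 with hM
  have hub : ∀ x, 0 ≤ x → x ≤ R → m x ≤ M := by
    intro x hx hxR
    have h1 := (abs_le.1 (hmc x 0 hx le_rfl)).2
    rw [sub_zero, abs_of_nonneg hx] at h1
    linarith [hωm.2.2.2.1 x 1 hx (by linarith)]
  have hM0 : 0 < M := hμ₁.trans_le ((hmlb 0 le_rfl).trans (hub 0 le_rfl hR.le))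
  set C := (2 + 3 * δ ^ 2 + M) / min (1 / 2) μ₁ with hCdef
  have hC : 1 ≤ C := by
    rw [hCdef, one_le_div (lt_min (by norm_num) hμ₁)]
    nlinarith [min_le_left (1 / 2) μ₁, sq_nonneg δ]
  refine ⟨R / (2 * C), by positivity, fun ωd hωd _ hωdα _ u0 u1 hu hsmall T hT u hsol hV => ?_⟩
  have hN : C * totalEnergy lam ωd u0 u1 < R := by
    have h1 : totalEnergy lam ωd u0 u1 ≤ R / (2 * C) := hsmall
    rw [le_div_iff₀ (by positivity)] at h1
    nlinarith
  have hN0 : totalEnergy lam ωd u0 u1 < R :=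
    lt_of_le_of_lt (le_mul_of_one_le_left (totalEnergy_nonneg hωd _ _) hC) hN
  have hE : ∀ c, IsAdmissible μ₁ M (coeffModulus ωm ωd (3 * R)) c → ∀ y z,
      IsModeFamily lam σ δ (Ici 0) u0 u1 c y z → ∀ k t, 0 ≤ t →
        z k t ^ 2 + lam k ^ 2 * y k t ^ 2 ≤ C * (u1 k ^ 2 + lam k ^ 2 * u0 k ^ 2) := by
    rw [hR3]
    exact fun c hc y z h k => h.energy_le hlam hωm hωd hσ0 hσ hδ hμ₁ (min_le_left _ _) hη2
      hR'0.le hR'η hR'l hωdα hc k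
  have hmodes := hsol.isModeFamily hT
  have hstay := hmodes.staysSmall hlam hωm hωd hmc hR.le hμ₁ hmlb hub hu hE hN0 hN
    (fun t ht => by simpa only [mul_pow] using hsol.2.2.2.2.2.1.1 t ht) hV.1
    (continuousOn_totalEnergy hωd hsol hV)
  obtain ⟨w, z, c, hc, hcw, hw, hwE, hwu⟩ := exists_global_modes hlam hωm hωd hmc hR.le hμ₁ hmlb
    hub hu hE hN.le hT.le hmodes hstay
  obtain ⟨h1, h2⟩ := isKirchhoffSol_of_isModeFamily hωd hu hc hcw hw hwE
  exact ⟨w, h1, h2, hwu⟩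
end
end

section
/- Let T > 0, let λ : ℕ → [0,∞) be a sequence, and let c_n, c_∞ : [0,T] → ℝ be measurable functions with 0 ≤ c_n(t) ≤ μ₂ and 0 ≤ c_∞(t) ≤ μ₂ for all t. Let σ and δ be positive real numbers such that either σ > 1/2, or σ = 1/2 and 4δ² ≥ μ₂. Assume (u⁰,u¹) ∈ D(A) × D(A^{1/2}) (i.e. Σ_k λ_k⁴ (u⁰_k)² < ∞ and Σ_k λ_k² (u¹_k)² < ∞, in addition to ℓ² membership), let u_n be a solution on [0,T] of the linear equation u'' + 2δ A^σ u' + c_n(t) A u = 0 with initial data (u⁰,u¹), and let u_∞ be a solution on [0,T] of the same equation with coefficient c_∞ and the same data. Then there exists a constant Γ > 0, depending only on δ, σ, μ₂ and T, such that for every t ∈ [0,T]: |u_∞'(t) − u_n'(t)|² + |A^{1/2}(u_∞(t) − u_n(t))|² ≤ Γ ( |A^{1/2}u¹|² + |A u⁰|² ) ∫₀ᵀ |c_n(s) − c_∞(s)|² ds. -/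
open Set Filter MeasureTheory Topology

noncomputable section

/-- A solution on `[0,T]` of the linear equation `u'' + 2δ A^σ u' + c(t) A u = 0` with
initial data `(u0, u1)`, in the diagonal setting.  Each component `u k` is `C¹` with
derivative `v k`, and `v k` is absolutely continuous with the equation holding a.e.,
which is encoded through the integral formulation; moreover the curves `t ↦ u(t)`,
`t ↦ A^{1/2}u(t)`, `t ↦ u'(t)` are continuous with values in `ℓ²`. -/
def IsLinearSol (lam : ℕ → ℝ) (c : ℝ → ℝ) (σ δ : ℝ) (T : ℝ)
    (u0 u1 : ℕ → ℝ) (u v : ℕ → ℝ → ℝ) : Prop :=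
  (∀ k, u k 0 = u0 k) ∧
  (∀ k, v k 0 = u1 k) ∧
  (∀ k, ∀ t ∈ Icc (0:ℝ) T, HasDerivWithinAt (u k) (v k t) (Icc 0 T) t) ∧
  (∀ k, ∀ t ∈ Icc (0:ℝ) T, v k t = u1 k - ∫ s in (0:ℝ)..t,
      (2 * δ * lam k ^ (2 * σ) * v k s + c s * lam k ^ 2 * u k s)) ∧
  L2Cont (Icc 0 T) (fun t k => u k t) ∧
  L2Cont (Icc 0 T) (fun t k => lam k * u k t) ∧
  L2Cont (Icc 0 T) (fun t k => v k t)

/-- Grönwall's inequality in differential form for absolutely continuous functions. -/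
theorem AbsolutelyContinuousOnInterval.le_exp_mul_add_integral {E E' g : ℝ → ℝ} {K T : ℝ}
    (hK : 0 ≤ K) (hE : AbsolutelyContinuousOnInterval E 0 T) (hE0 : 0 ≤ E 0)
    (hg : IntervalIntegrable g volume 0 T) (hg0 : ∀ x ∈ Ioo 0 T, 0 ≤ g x)
    (hE' : ∀ᵐ x, x ∈ Ioo 0 T → HasDerivAt E (E' x) x ∧ E' x ≤ K * E x + g x)
    {t : ℝ} (ht : t ∈ Icc 0 T) :
    E t ≤ Real.exp (K * T) * (E 0 + ∫ s in (0:ℝ)..T, g s) := by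
  obtain ⟨ht0, htT⟩ := ht
  have hsub : uIcc 0 t ⊆ uIcc 0 T := by
    rw [uIcc_of_le ht0, uIcc_of_le (ht0.trans htT)]; exact Icc_subset_Icc_right htT
  have hexp : AbsolutelyContinuousOnInterval (fun x : ℝ => Real.exp (-K * x)) 0 t :=
    ContDiffOn.absolutelyContinuousOnInterval (by fun_prop)
  have hH := hexp.mul (hE.mono hsub)
  have hgt : IntervalIntegrable g volume 0 t := hg.mono_set hsub
  have hne : ∀ᵐ x : ℝ, x ≠ t := by simp [ae_iff, measure_singleton]
  have key : ∫ x in (0:ℝ)..t, deriv ((fun x : ℝ => Real.exp (-K * x)) * E) x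
      ≤ ∫ x in (0:ℝ)..t, g x := by
    refine intervalIntegral.integral_mono_ae_restrict ht0 hH.intervalIntegrable_deriv hgt ?_
    have hne0 : ∀ᵐ x : ℝ, x ≠ 0 := by simp [ae_iff, measure_singleton]
    rw [EventuallyLE, ae_restrict_iff' measurableSet_Icc]
    filter_upwards [hE', hne, hne0] with x hx hxt hx0 hxI
    have hxI' : x ∈ Ioo 0 T :=
      ⟨lt_of_le_of_ne hxI.1 (Ne.symm hx0), (lt_of_le_of_ne hxI.2 hxt).trans_le htT⟩
    obtain ⟨h1, h2⟩ := hx hxI'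
    have h3 : HasDerivAt (fun x : ℝ => Real.exp (-K * x)) (Real.exp (-K * x) * (-K)) x := by
      simpa using ((hasDerivAt_id x).const_mul (-K)).exp
    rw [(h3.mul h1).deriv]
    have h4 : Real.exp (-K * x) ≤ 1 := Real.exp_le_one_iff.2 (by nlinarith [hxI.1])
    nlinarith [Real.exp_pos (-K * x), hg0 x hxI',
      mul_le_mul_of_nonneg_left h2 (Real.exp_pos (-K * x)).le]
  rw [hH.integral_deriv_eq_sub] at key
  have hmono : ∫ x in (0:ℝ)..t, g x ≤ ∫ x in (0:ℝ)..T, g x := by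
    rw [← intervalIntegral.integral_add_adjacent_intervals hgt
      (hg.mono_set (uIcc_subset_uIcc (by rw [uIcc_of_le (ht0.trans htT)]; exact ⟨ht0, htT⟩)
        right_mem_uIcc))]
    have : 0 ≤ ∫ x in t..T, g x := by
      rw [intervalIntegral.integral_of_le htT, ← integral_Ioc_eq_integral_Ioo.symm]
      exact setIntegral_nonneg measurableSet_Ioo fun x hx => hg0 x ⟨ht0.trans_lt hx.1, hx.2⟩
    linarith
  have hg_nonneg : 0 ≤ ∫ x in (0:ℝ)..T, g x := by
    rw [intervalIntegral.integral_of_le (ht0.trans htT), integral_Ioc_eq_integral_Ioo]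
    exact setIntegral_nonneg measurableSet_Ioo hg0
  simp only [Pi.mul_apply, mul_zero, Real.exp_zero, one_mul] at key
  have h5 : E t = Real.exp (K * t) * (Real.exp (-K * t) * E t) := by
    rw [← mul_assoc, ← Real.exp_add]; simp
  rw [h5]
  calc _ ≤ Real.exp (K * t) * (E 0 + ∫ s in (0:ℝ)..T, g s) := by gcongr; linarith
    _ ≤ _ := by gcongr

/-- The scalar damped oscillator `p'' + b p' + c(t) l² p = f(t)` on `[0,T]`, with `q = p'`. -/
structure IsDampedMode (l b : ℝ) (c f : ℝ → ℝ) (T : ℝ) (p q : ℝ → ℝ) : Prop where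
  ac_fst : AbsolutelyContinuousOnInterval p 0 T
  ac_snd : AbsolutelyContinuousOnInterval q 0 T
  hasDerivAt_fst : ∀ t ∈ Ioo 0 T, HasDerivAt p (q t) t
  hasDerivAt_snd : ∀ᵐ t, t ∈ Ioo 0 T →
    HasDerivAt q (-(b * q t) - c t * l ^ 2 * p t + f t) t

namespace IsDampedMode

variable {l b T μ : ℝ} {c f p q : ℝ → ℝ}

/-- The difference of two unforced modes with different coefficients is a forced mode. -/
theorem sub {c' p' q' : ℝ → ℝ} (h' : IsDampedMode l b c' 0 T p' q')
    (h : IsDampedMode l b c 0 T p q) :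
    IsDampedMode l b c (fun t => (c t - c' t) * (l ^ 2 * p' t)) T (p' - p) (q' - q) where
  ac_fst := h'.ac_fst.sub h.ac_fst
  ac_snd := h'.ac_snd.sub h.ac_snd
  hasDerivAt_fst t ht := (h'.hasDerivAt_fst t ht).sub (h.hasDerivAt_fst t ht)
  hasDerivAt_snd := by
    filter_upwards [h.hasDerivAt_snd, h'.hasDerivAt_snd] with t h1 h2 ht
    convert! (h2 ht).sub (h1 ht) using 1
    simp only [Pi.sub_apply, Pi.zero_apply]
    ring

/-- When the damping dominates, i.e. `μ l² ≤ b²`, the energy `q² + (q + b p)²` is controlled. -/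
theorem dissipative_energy_le (h : IsDampedMode l b c f T p q) (hb : 0 ≤ b)
    (hc : ∀ t ∈ Icc 0 T, 0 ≤ c t ∧ c t ≤ μ) (hbl : μ * l ^ 2 ≤ b ^ 2)
    (hf : IntervalIntegrable (fun t => f t ^ 2) volume 0 T) {t : ℝ} (ht : t ∈ Icc 0 T) :
    q t ^ 2 + (q t + b * p t) ^ 2 ≤ Real.exp T *
      (q 0 ^ 2 + (q 0 + b * p 0) ^ 2 + 2 * ∫ s in (0:ℝ)..T, f s ^ 2) := by
  have hac : AbsolutelyContinuousOnInterval (fun t => q t ^ 2 + (q t + b * p t) ^ 2) 0 T := by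
    have h1 := h.ac_snd.add (h.ac_fst.const_mul b)
    convert! (h.ac_snd.mul h.ac_snd).add (h1.mul h1) using 1
    ext t; simp [sq]
  have := hac.le_exp_mul_add_integral (K := 1) (g := fun t => 2 * f t ^ 2)
    (E' := fun t => 2 * q t * (-(b * q t) - c t * l ^ 2 * p t + f t) +
      2 * (q t + b * p t) * ((-(b * q t) - c t * l ^ 2 * p t + f t) + b * q t))
    zero_le_one (by positivity) (hf.const_mul 2) (fun x _ => by positivity) ?_ ht
  · simpa only [one_mul, intervalIntegral.integral_const_mul] using this
  filter_upwards [h.hasDerivAt_snd] with x hx hxI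
  have hq := hx hxI
  have hp := h.hasDerivAt_fst x hxI
  refine ⟨?_, ?_⟩
  · convert! (hq.fun_pow 2).add ((hq.fun_add (hp.const_mul b)).fun_pow 2) using 1
    simp
  · obtain ⟨hc0, hcμ⟩ := hc x (Ioo_subset_Icc_self hxI)
    have ha : c x * l ^ 2 ≤ b ^ 2 :=
      (mul_le_mul_of_nonneg_right hcμ (sq_nonneg l)).trans hbl
    have ha0 : 0 ≤ c x * l ^ 2 := by positivity
    generalize c x * l ^ 2 = a at ha ha0 ⊢
    have hform : 0 ≤ b * q x ^ 2 + 2 * (a * q x * p x) + b * (a * p x ^ 2) := by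
      rcases hb.eq_or_lt with rfl | hb
      · have : a = 0 := le_antisymm (by simpa using ha) ha0
        simp [this]
      · refine nonneg_of_mul_nonneg_right (a := b) ?_ hb
        nlinarith [sq_nonneg (b * q x + a * p x),
          mul_nonneg (mul_nonneg ha0 (sub_nonneg.2 ha)) (sq_nonneg (p x))]
    nlinarith [sq_nonneg (q x - f x), sq_nonneg (q x + b * p x - f x)]

/-- Growth bound for the standard energy `q² + l² p²` at bounded frequency `l`. -/
theorem energy_le {L : ℝ} (h : IsDampedMode l b c f T p q) (hb : 0 ≤ b) (hl : 0 ≤ l)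
    (hlL : l ≤ L) (hμ : 0 ≤ μ) (hc : ∀ t ∈ Icc 0 T, 0 ≤ c t ∧ c t ≤ μ)
    (hf : IntervalIntegrable (fun t => f t ^ 2) volume 0 T) {t : ℝ} (ht : t ∈ Icc 0 T) :
    q t ^ 2 + l ^ 2 * p t ^ 2 ≤ Real.exp (((1 + μ) * L + 1) * T) *
      (q 0 ^ 2 + l ^ 2 * p 0 ^ 2 + ∫ s in (0:ℝ)..T, f s ^ 2) := by
  have hac : AbsolutelyContinuousOnInterval (fun t => q t ^ 2 + l ^ 2 * p t ^ 2) 0 T := by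
    convert! (h.ac_snd.mul h.ac_snd).add ((h.ac_fst.mul h.ac_fst).const_mul (l ^ 2)) using 1
    ext t; simp [sq]
  have hL : 0 ≤ L := hl.trans hlL
  refine hac.le_exp_mul_add_integral (g := fun t => f t ^ 2)
    (E' := fun t => 2 * q t * (-(b * q t) - c t * l ^ 2 * p t + f t) +
      l ^ 2 * (2 * p t * q t))
    (by positivity) (by positivity) hf (fun x _ => by positivity) ?_ ht
  filter_upwards [h.hasDerivAt_snd] with x hx hxI
  have hq := hx hxI
  have hp := h.hasDerivAt_fst x hxI
  refine ⟨?_, ?_⟩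
  · convert! (hq.fun_pow 2).add ((hp.fun_pow 2).const_mul (l ^ 2)) using 1
    simp
  · obtain ⟨hc0, hcμ⟩ := hc x (Ioo_subset_Icc_self hxI)
    have hE : 0 ≤ q x ^ 2 + l ^ 2 * p x ^ 2 := by positivity
    have h1 : 2 * (q x * (l * p x)) ≤ q x ^ 2 + l ^ 2 * p x ^ 2 := by
      nlinarith [sq_nonneg (q x - l * p x)]
    have h2 : -(2 * (q x * (l * p x))) ≤ q x ^ 2 + l ^ 2 * p x ^ 2 := by
      nlinarith [sq_nonneg (q x + l * p x)]
    have h3 : (l * (1 - c x)) * (2 * (q x * (l * p x))) ≤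
        ((1 + μ) * L) * (q x ^ 2 + l ^ 2 * p x ^ 2) := by
      have h4 : (1 - c x) * (2 * (q x * (l * p x))) ≤
          (1 + μ) * (q x ^ 2 + l ^ 2 * p x ^ 2) := by
        nlinarith [mul_le_mul_of_nonneg_left h2 hc0, mul_le_mul_of_nonneg_right hcμ hE]
      calc _ = l * ((1 - c x) * (2 * (q x * (l * p x)))) := by ring
        _ ≤ l * ((1 + μ) * (q x ^ 2 + l ^ 2 * p x ^ 2)) := by gcongr
        _ ≤ L * ((1 + μ) * (q x ^ 2 + l ^ 2 * p x ^ 2)) := by gcongr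
        _ = _ := by ring
    nlinarith [sq_nonneg (q x - f x), mul_nonneg hb (sq_nonneg (q x)),
      mul_nonneg (sq_nonneg l) (sq_nonneg (p x))]

/-- Stability of modes with a constant uniform in the frequency: propagation of the elastic energy
for unforced modes, and control of the energy by the forcing term for zero initial data. -/
theorem exists_stability_constant (hμ : 0 ≤ μ) (T K L : ℝ) :
    ∃ C > (0:ℝ), ∀ (l b : ℝ) (c f p q : ℝ → ℝ), 0 ≤ l → 0 ≤ b →
      (l ≤ L ∨ l ≤ K * b ∧ μ * l ^ 2 ≤ b ^ 2) →
      (∀ t ∈ Icc 0 T, 0 ≤ c t ∧ c t ≤ μ) →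
      IsDampedMode l b c f T p q → ∀ t ∈ Icc 0 T,
      (f = 0 → l ^ 2 * p t ^ 2 ≤ C * (q 0 ^ 2 + l ^ 2 * p 0 ^ 2)) ∧
      (p 0 = 0 → q 0 = 0 → IntervalIntegrable (fun t => f t ^ 2) volume 0 T →
        q t ^ 2 + l ^ 2 * p t ^ 2 ≤ C * ∫ s in (0:ℝ)..T, f s ^ 2) := by
  set C₁ := Real.exp (((1 + μ) * L + 1) * T)
  set C₂ := Real.exp T * (6 * K ^ 2 + 4)
  have hC₁ : 0 < C₁ := Real.exp_pos _
  have hC₂ : 0 < C₂ := by positivity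
  refine ⟨C₁ + C₂, by positivity, fun l b c f p q hl hb hlb hc h t ht => ?_⟩
  have hT : 0 ≤ T := ht.1.trans ht.2
  have hI : 0 ≤ ∫ s in (0:ℝ)..T, f s ^ 2 :=
    intervalIntegral.integral_nonneg hT fun _ _ => sq_nonneg _
  have hD : 0 ≤ q 0 ^ 2 + l ^ 2 * p 0 ^ 2 := by positivity
  rcases hlb with hlL | ⟨hlK, hbl⟩
  · constructor
    · rintro rfl
      have := h.energy_le hb hl hlL hμ hc (by simp) ht
      simp only [Pi.zero_apply, ne_eq, OfNat.ofNat_ne_zero, not_false_eq_true, zero_pow,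
        intervalIntegral.integral_zero, add_zero] at this
      nlinarith [sq_nonneg (q t), mul_nonneg hC₂.le hD]
    · intro hp0 hq0 hf
      have := h.energy_le hb hl hlL hμ hc hf ht
      simp only [hp0, hq0, ne_eq, OfNat.ofNat_ne_zero, not_false_eq_true, zero_pow, mul_zero,
        add_zero, zero_add] at this
      nlinarith [mul_nonneg hC₂.le hI]
  · have hl2 : l ^ 2 ≤ K ^ 2 * b ^ 2 := by
      rw [← mul_pow]; exact pow_le_pow_left₀ hl hlK 2
    have hbp : b ^ 2 * p t ^ 2 ≤ 2 * (q t ^ 2 + (q t + b * p t) ^ 2) := by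
      nlinarith [sq_nonneg (q t + (q t + b * p t))]
    constructor
    · rintro rfl
      have hE := h.dissipative_energy_le hb hc hbl (by simp) ht
      simp only [Pi.zero_apply, ne_eq, OfNat.ofNat_ne_zero, not_false_eq_true, zero_pow,
        intervalIntegral.integral_zero, add_zero, mul_zero] at hE
      have hmain : l ^ 2 * p t ^ 2 ≤ C₂ * (q 0 ^ 2 + l ^ 2 * p 0 ^ 2) := by
        rcases hb.eq_or_lt with rfl | hb
        · have : l = 0 := le_antisymm (by simpa using hlK) hl
          simp only [this, ne_eq, OfNat.ofNat_ne_zero, not_false_eq_true, zero_pow, zero_mul]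
          positivity
        · have h0 : q 0 ^ 2 + (q 0 + b * p 0) ^ 2 ≤ 3 * q 0 ^ 2 + 2 * (b ^ 2 * p 0 ^ 2) := by
            nlinarith [sq_nonneg (q 0 - b * p 0)]
          have h1 : b ^ 2 * p t ^ 2 ≤
              Real.exp T * (6 * q 0 ^ 2 + 4 * (b ^ 2 * p 0 ^ 2)) := by
            nlinarith [mul_le_mul_of_nonneg_left h0 (Real.exp_pos T).le]
          have hb2 : 0 < b ^ 2 := by positivity
          refine le_of_mul_le_mul_left ?_ hb2
          calc b ^ 2 * (l ^ 2 * p t ^ 2) = l ^ 2 * (b ^ 2 * p t ^ 2) := by ring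
            _ ≤ l ^ 2 * (Real.exp T * (6 * q 0 ^ 2 + 4 * (b ^ 2 * p 0 ^ 2))) := by gcongr
            _ = Real.exp T * (6 * l ^ 2 * q 0 ^ 2 + 4 * (b ^ 2 * (l ^ 2 * p 0 ^ 2))) := by ring
            _ ≤ Real.exp T * (6 * (K ^ 2 * b ^ 2) * q 0 ^ 2
                  + 4 * (b ^ 2 * (l ^ 2 * p 0 ^ 2))) := by gcongr
            _ ≤ Real.exp T * (6 * (K ^ 2 * b ^ 2) * q 0 ^ 2
                  + 4 * (b ^ 2 * (l ^ 2 * p 0 ^ 2))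
                  + (4 * b ^ 2 * q 0 ^ 2 + 6 * K ^ 2 * b ^ 2 * (l ^ 2 * p 0 ^ 2))) := by
              exact mul_le_mul_of_nonneg_left (le_add_of_nonneg_right (by positivity))
                (Real.exp_pos T).le
            _ = b ^ 2 * (C₂ * (q 0 ^ 2 + l ^ 2 * p 0 ^ 2)) := by
              simp only [C₂]; ring
      nlinarith [mul_nonneg hC₁.le hD]
    · intro hp0 hq0 hf
      have hE := h.dissipative_energy_le hb hc hbl hf ht
      simp only [hp0, hq0, ne_eq, OfNat.ofNat_ne_zero, not_false_eq_true, zero_pow, mul_zero,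
        add_zero, zero_add] at hE
      have h1 : l ^ 2 * p t ^ 2 ≤ K ^ 2 * (b ^ 2 * p t ^ 2) := by
        rw [← mul_assoc]; gcongr
      have h2 : K ^ 2 * (b ^ 2 * p t ^ 2) ≤
          K ^ 2 * (2 * (q t ^ 2 + (q t + b * p t) ^ 2)) := by gcongr
      have h3 : q t ^ 2 + l ^ 2 * p t ^ 2 ≤
          (1 + 2 * K ^ 2) * (q t ^ 2 + (q t + b * p t) ^ 2) := by
        nlinarith [sq_nonneg (q t + b * p t)]
      calc _ ≤ (1 + 2 * K ^ 2) * (q t ^ 2 + (q t + b * p t) ^ 2) := h3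
        _ ≤ (1 + 2 * K ^ 2) * (Real.exp T * (2 * ∫ s in (0:ℝ)..T, f s ^ 2)) := by gcongr
        _ ≤ (1 + 2 * K ^ 2) * (Real.exp T * (2 * ∫ s in (0:ℝ)..T, f s ^ 2)) +
            (C₁ * (∫ s in (0:ℝ)..T, f s ^ 2) +
              Real.exp T * (2 * K ^ 2 + 2) * ∫ s in (0:ℝ)..T, f s ^ 2) :=
          le_add_of_nonneg_right (by positivity)
        _ = _ := by simp only [C₂]; ring

end IsDampedMode

/-- For `σ > 1/2`, or `σ = 1/2` with `μ ≤ 4δ²`, the damping dominates at all frequencies outside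
a bounded range. -/
theorem exists_frequency_threshold {δ σ μ : ℝ} (hδ : 0 < δ) (hμ : 0 ≤ μ)
    (hcase : 1 / 2 < σ ∨ (σ = 1 / 2 ∧ μ ≤ 4 * δ ^ 2)) :
    ∃ K L : ℝ, ∀ l : ℝ, 0 ≤ l → (l ≤ L ∨
      l ≤ K * (2 * δ * l ^ (2 * σ)) ∧ μ * l ^ 2 ≤ (2 * δ * l ^ (2 * σ)) ^ 2) := by
  rcases hcase with hσ | ⟨rfl, hμδ⟩
  · have htend : Tendsto (fun l : ℝ => l ^ (2 * σ - 1)) atTop atTop :=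
      tendsto_rpow_atTop (by linarith)
    obtain ⟨L, hL⟩ := eventually_atTop.1 (htend.eventually_ge_atTop ((1 + μ) / (2 * δ)))
    refine ⟨1, max L 0, fun l hl => ?_⟩
    rcases le_or_gt l (max L 0) with h | h
    · exact Or.inl h
    right
    have hl0 : 0 < l := (le_max_right _ _).trans_lt h
    have h1 := hL l ((le_max_left _ _).trans h.le)
    rw [div_le_iff₀ (by positivity)] at h1
    have h2 : l ^ (2 * σ) = l * l ^ (2 * σ - 1) := by
      rw [Real.rpow_sub_one hl0.ne']; field_simp
    have h3 : (1 + μ) * l ≤ 2 * δ * l ^ (2 * σ) := by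
      rw [h2]; nlinarith
    have h4 : ((1 + μ) * l) ^ 2 ≤ (2 * δ * l ^ (2 * σ)) ^ 2 :=
      pow_le_pow_left₀ (by positivity) h3 2
    constructor
    · nlinarith
    · nlinarith [sq_nonneg l, mul_nonneg hμ (sq_nonneg l),
        mul_nonneg (mul_nonneg hμ hμ) (sq_nonneg l)]
  · refine ⟨1 / (2 * δ), 0, fun l _ => Or.inr ?_⟩
    rw [mul_one_div_cancel two_ne_zero, Real.rpow_one]
    constructor
    · field_simp; rfl
    · nlinarith [sq_nonneg l]

/-- The components of an `ℓ²`-continuous curve are continuous. -/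
theorem L2Cont.continuousOn {I : Set ℝ} {v : ℝ → ℕ → ℝ} (h : L2Cont I v) (k : ℕ) :
    ContinuousOn (fun t => v t k) I := by
  rw [Metric.continuousOn_iff]
  intro t ht ε hε
  obtain ⟨η, hη, H⟩ := h.2 t ht (ε ^ 2) (by positivity)
  refine ⟨η, hη, fun s hs hst => ?_⟩
  have hsum : Summable fun k => (v s k - v t k) ^ 2 := by
    refine Summable.of_nonneg_of_le (fun _ => sq_nonneg _) (fun j => ?_)
      (((h.1 s hs).add (h.1 t ht)).mul_left 2)
    nlinarith [sq_nonneg (v s j + v t j)]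
  have h1 := (hsum.le_tsum k fun _ _ => sq_nonneg _).trans_lt (H s hs hst)
  rw [Real.dist_eq]
  exact abs_lt_of_sq_lt_sq h1 hε.le

theorem AbsolutelyContinuousOnInterval.congr {f g : ℝ → ℝ} {a b : ℝ}
    (hf : AbsolutelyContinuousOnInterval f a b) (hfg : EqOn f g (uIcc a b)) :
    AbsolutelyContinuousOnInterval g a b := by
  rw [absolutelyContinuousOnInterval_iff] at hf ⊢
  intro ε hε
  obtain ⟨η, hη, H⟩ := hf ε hε
  refine ⟨η, hη, fun E hE hEη => ?_⟩
  refine (Finset.sum_congr rfl fun i hi => ?_).trans_lt (H E hE hEη)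
  have := hE.1 i hi
  rw [hfg this.1, hfg this.2]

theorem memLp_top_of_mem_Icc {T μ : ℝ} {c : ℝ → ℝ}
    (hc : AEMeasurable c (volume.restrict (Icc 0 T)))
    (hcμ : ∀ t ∈ Icc (0:ℝ) T, 0 ≤ c t ∧ c t ≤ μ) :
    MemLp c ⊤ (volume.restrict (Icc 0 T)) := by
  refine memLp_top_of_bound hc.aestronglyMeasurable μ ?_
  rw [ae_restrict_iff' measurableSet_Icc]
  refine Eventually.of_forall fun t ht => ?_
  rw [Real.norm_eq_abs, abs_of_nonneg (hcμ t ht).1]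
  exact (hcμ t ht).2

/-- Each component of a solution is an unforced damped mode. -/
theorem IsLinearSol.isDampedMode {lam u0 u1 : ℕ → ℝ} {c : ℝ → ℝ} {σ δ T μ : ℝ}
    {u v : ℕ → ℝ → ℝ} (h : IsLinearSol lam c σ δ T u0 u1 u v) (hT : 0 ≤ T)
    (hc : AEMeasurable c (volume.restrict (Icc 0 T)))
    (hcμ : ∀ t ∈ Icc (0:ℝ) T, 0 ≤ c t ∧ c t ≤ μ) (k : ℕ) :
    IsDampedMode (lam k) (2 * δ * lam k ^ (2 * σ)) c 0 T (u k) (v k) := by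
  obtain ⟨-, -, hu', hv, huc, -, hvc⟩ := h
  have hu := huc.continuousOn k
  have hvk := hvc.continuousOn k
  have hint : IntervalIntegrable
      (fun s => 2 * δ * lam k ^ (2 * σ) * v k s + c s * lam k ^ 2 * u k s) volume 0 T := by
    rw [intervalIntegrable_iff_integrableOn_Icc_of_le hT]
    refine Integrable.add ((hvk.integrableOn_compact isCompact_Icc).const_mul _) ?_
    have h1 : IntegrableOn (fun s => lam k ^ 2 * u k s) (Icc 0 T) :=
      (hu.integrableOn_compact isCompact_Icc).const_mul _
    simpa only [mul_assoc] using! h1.mul_of_top_right (memLp_top_of_mem_Icc hc hcμ)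
  have hder : ∀ t ∈ Ioo 0 T, HasDerivAt (u k) (v k t) t := fun t ht =>
    (hu' k t (Ioo_subset_Icc_self ht)).hasDerivAt (Icc_mem_nhds ht.1 ht.2)
  have hvint : IntervalIntegrable (v k) volume 0 T :=
    ContinuousOn.intervalIntegrable (by rwa [uIcc_of_le hT])
  refine ⟨?_, ?_, hder, ?_⟩
  · have h1 := hvint.absolutelyContinuousOnInterval_intervalIntegral (c := 0) left_mem_uIcc
    have h2 : AbsolutelyContinuousOnInterval (fun _ : ℝ => u k 0) 0 T :=
      contDiffOn_const.absolutelyContinuousOnInterval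
    refine (h2.add h1).congr fun t ht => ?_
    rw [uIcc_of_le hT] at ht
    have := intervalIntegral.integral_eq_sub_of_hasDerivAt_of_le ht.1
      (hu.mono (Icc_subset_Icc_right ht.2))
      (fun x hx => hder x ⟨hx.1, hx.2.trans_le ht.2⟩)
      (hvint.mono_set (by
        rw [uIcc_of_le ht.1, uIcc_of_le hT]; exact Icc_subset_Icc_right ht.2))
    simp [this]
  · have h1 := hint.absolutelyContinuousOnInterval_intervalIntegral (c := 0) left_mem_uIcc
    have h2 : AbsolutelyContinuousOnInterval (fun _ : ℝ => u1 k) 0 T :=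
      contDiffOn_const.absolutelyContinuousOnInterval
    refine (h2.sub h1).congr fun t ht => ?_
    rw [uIcc_of_le hT] at ht
    exact (hv k t ht).symm
  · filter_upwards [hint.ae_hasDerivAt_integral] with t ht htI
    have h1 := ht (by rw [uIcc_of_le hT]; exact Ioo_subset_Icc_self htI) 0 left_mem_uIcc
    have h2 := (h1.const_sub (u1 k)).congr_of_eventuallyEq (f₁ := v k) (by
      filter_upwards [Icc_mem_nhds htI.1 htI.2] with s hs using hv k s hs)
    convert! h2 using 1
    simp only [Pi.zero_apply]
    ring

/-- Quantitative convergence for regular data: for initial data in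
`D(A) × D(A^{1/2})`, the distance in the energy space between the solutions with
coefficients `c n` and `c∞` is controlled by the `L²` distance of the coefficients,
with a constant depending only on `δ`, `σ`, `μ₂` and `T`. -/
theorem convergence_rate_regular_data
    (δ σ μ₂ T : ℝ) (hδ : 0 < δ) (hσ : 0 < σ) (hT : 0 < T)
    (hcase : 1 / 2 < σ ∨ (σ = 1 / 2 ∧ μ₂ ≤ 4 * δ ^ 2)) :
    ∃ Γ > (0:ℝ),
      ∀ lam : ℕ → ℝ, (∀ k, 0 ≤ lam k) →
      ∀ (c : ℕ → ℝ → ℝ) (cinf : ℝ → ℝ),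
        (∀ n, AEMeasurable (c n) (volume.restrict (Icc 0 T))) →
        AEMeasurable cinf (volume.restrict (Icc 0 T)) →
        (∀ n, ∀ t ∈ Icc (0:ℝ) T, 0 ≤ c n t ∧ c n t ≤ μ₂) →
        (∀ t ∈ Icc (0:ℝ) T, 0 ≤ cinf t ∧ cinf t ≤ μ₂) →
      ∀ u0 u1 : ℕ → ℝ,
        (Summable fun k => u0 k ^ 2) →
        (Summable fun k => lam k ^ 4 * u0 k ^ 2) →
        (Summable fun k => u1 k ^ 2) →
        (Summable fun k => lam k ^ 2 * u1 k ^ 2) →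
      ∀ (u v : ℕ → ℕ → ℝ → ℝ) (uinf vinf : ℕ → ℝ → ℝ),
        (∀ n, IsLinearSol lam (c n) σ δ T u0 u1 (u n) (v n)) →
        IsLinearSol lam cinf σ δ T u0 u1 uinf vinf →
      ∀ n : ℕ, ∀ t ∈ Icc (0:ℝ) T,
        (∑' k, (vinf k t - v n k t) ^ 2) +
            (∑' k, lam k ^ 2 * (uinf k t - u n k t) ^ 2) ≤
          Γ * ((∑' k, lam k ^ 2 * u1 k ^ 2) + (∑' k, lam k ^ 4 * u0 k ^ 2)) *
            ∫ s in (0:ℝ)..T, (c n s - cinf s) ^ 2 := by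
  rcases lt_or_ge μ₂ 0 with hμ | hμ
  · refine ⟨1, one_pos, ?_⟩
    intro lam _ c cinf _ _ _ hcinf
    have := hcinf 0 ⟨le_rfl, hT.le⟩
    linarith
  obtain ⟨K, L, hKL⟩ := exists_frequency_threshold hδ hμ hcase
  obtain ⟨C, hC, H⟩ := IsDampedMode.exists_stability_constant hμ T K L
  refine ⟨C ^ 2, by positivity, ?_⟩
  intro lam hlam c cinf hcm hcim hc hcinf u0 u1 _ hu0 _ hu1 u v uinf vinf hsol hsolinf n t ht
  set I := ∫ s in (0:ℝ)..T, (c n s - cinf s) ^ 2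
  have hint : IntervalIntegrable (fun s => (c n s - cinf s) ^ 2) volume 0 T := by
    rw [intervalIntegrable_iff_integrableOn_Icc_of_le hT.le]
    exact (((memLp_top_of_mem_Icc (hcm n) (hc n)).sub
      (memLp_top_of_mem_Icc hcim hcinf)).mono_exponent le_top).integrable_sq
  have hmode : ∀ k, (vinf k t - v n k t) ^ 2 + lam k ^ 2 * (uinf k t - u n k t) ^ 2 ≤
      C ^ 2 * (lam k ^ 2 * u1 k ^ 2 + lam k ^ 4 * u0 k ^ 2) * I := by
    intro k
    have hb : 0 ≤ 2 * δ * lam k ^ (2 * σ) :=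
      mul_nonneg (by positivity) (Real.rpow_nonneg (hlam k) _)
    have hinf := hsolinf.isDampedMode hT.le hcim hcinf k
    have hn := (hsol n).isDampedMode hT.le (hcm n) (hc n) k
    have hreg : ∀ s ∈ Icc 0 T, (lam k ^ 2 * uinf k s) ^ 2 ≤
        C * (lam k ^ 2 * u1 k ^ 2 + lam k ^ 4 * u0 k ^ 2) := by
      intro s hs
      have h1 := (H _ _ _ _ _ _ (hlam k) hb (hKL _ (hlam k)) hcinf hinf s hs).1 rfl
      rw [hsolinf.1 k, hsolinf.2.1 k] at h1
      nlinarith [mul_le_mul_of_nonneg_left h1 (sq_nonneg (lam k))]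
    have hdom : IntervalIntegrable (fun s => (c n s - cinf s) ^ 2 *
        (C * (lam k ^ 2 * u1 k ^ 2 + lam k ^ 4 * u0 k ^ 2))) volume 0 T := hint.mul_const _
    have hf : IntervalIntegrable
        (fun s => ((c n s - cinf s) * (lam k ^ 2 * uinf k s)) ^ 2) volume 0 T := by
      have hcont : ContinuousOn (fun s => (lam k ^ 2 * uinf k s) ^ 2) (uIcc 0 T) :=
        (hinf.ac_fst.continuousOn.const_mul _).pow 2
      simpa only [mul_pow] using hint.mul_continuousOn hcont
    have h2 := (H _ _ _ _ _ _ (hlam k) hb (hKL _ (hlam k)) (hc n) (hinf.sub hn) t ht).2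
      (by simp [hsolinf.1 k, (hsol n).1 k]) (by simp [hsolinf.2.1 k, (hsol n).2.1 k]) hf
    have h3 := intervalIntegral.integral_mono_on hT.le hf hdom fun s hs => by
      rw [mul_pow]
      exact mul_le_mul_of_nonneg_left (hreg s hs) (sq_nonneg _)
    rw [intervalIntegral.integral_mul_const] at h3
    calc _ ≤ C * ∫ s in (0:ℝ)..T, ((c n s - cinf s) * (lam k ^ 2 * uinf k s)) ^ 2 := h2
      _ ≤ C * (I * (C * (lam k ^ 2 * u1 k ^ 2 + lam k ^ 4 * u0 k ^ 2))) := by gcongr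
      _ = _ := by ring
  have hR : Summable fun k => C ^ 2 * (lam k ^ 2 * u1 k ^ 2 + lam k ^ 4 * u0 k ^ 2) * I :=
    ((hu1.add hu0).mul_left _).mul_right _
  have hS1 : Summable fun k => (vinf k t - v n k t) ^ 2 :=
    hR.of_nonneg_of_le (fun _ => sq_nonneg _) fun k =>
      (le_add_of_nonneg_right (by positivity)).trans (hmode k)
  have hS2 : Summable fun k => lam k ^ 2 * (uinf k t - u n k t) ^ 2 :=
    hR.of_nonneg_of_le (fun _ => by positivity) fun k =>
      (le_add_of_nonneg_left (by positivity)).trans (hmode k)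
  rw [← hS1.tsum_add hS2, ← hu1.tsum_add hu0, ← tsum_mul_left, ← tsum_mul_right]
  exact (hS1.add hS2).tsum_le_tsum hmode hR
end
end

section
/- Let σ ∈ (0,1/2), let α ∈ (0,1/4), and let ω_m and ω_d be continuity moduli such that limsup_{x→0⁺} (ω_m(x))^{4α} / x^{1−2σ} < +∞ and lim_{x→0⁺} ω_d(x)/x^{4α} = 0. Then lim_{x→0⁺} ω_m(ω_d(x)) / x^{1−2σ} = 0. -/
open Set Filter MeasureTheory Topology

noncomputable section

lemma IsModulus.tendsto_nhdsGT_zero {ω : ℝ → ℝ} (h : IsModulus ω) :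
    Tendsto ω (𝓝[>] (0:ℝ)) (𝓝[>] (0:ℝ)) := by
  obtain ⟨hc, h0, hpos, -⟩ := h
  refine tendsto_nhdsWithin_iff.2 ⟨?_, ?_⟩
  · have := (hc 0 self_mem_Ici).mono_left (nhdsWithin_mono 0 Ioi_subset_Ici_self)
    rwa [h0] at this
  · filter_upwards [self_mem_nhdsWithin] with x hx using hpos x hx

lemma div_rpow_eq_rpow_mul_rpow {x y z p : ℝ} (q : ℝ) (hx : 0 < x) (hy : 0 < y) (hz : 0 < z)
    (hp : p ≠ 0) : z / x ^ q = (z ^ p / y ^ q) ^ p⁻¹ * (y / x ^ p) ^ (q / p) := by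
  rw [Real.div_rpow (by positivity) (by positivity), Real.div_rpow hy.le (by positivity),
    Real.rpow_rpow_inv hz.le hp, ← Real.rpow_mul hy.le, ← Real.rpow_mul hx.le,
    mul_div_cancel₀ q hp, ← div_eq_mul_inv]
  have : y ^ (q / p) ≠ 0 := by positivity
  field_simp

/-- Composition of moduli: if `(ωm x)^{4α} / x^{1-2σ}` is bounded near `0⁺` and
`ωd x / x^{4α} → 0`, then `ωm (ωd x) / x^{1-2σ} → 0` as `x → 0⁺`. -/
theorem composed_modulus_limit
    (σ α : ℝ) (hσ0 : 0 < σ) (hσ : σ < 1 / 2) (hα0 : 0 < α) (hα1 : α < 1 / 4)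
    (ωm ωd : ℝ → ℝ) (hωm : IsModulus ωm) (hωd : IsModulus ωd)
    (hlimsup : ∃ C : ℝ, ∀ᶠ x in 𝓝[>] (0:ℝ), ωm x ^ (4 * α) / x ^ (1 - 2 * σ) ≤ C)
    (hlim : Tendsto (fun x => ωd x / x ^ (4 * α)) (𝓝[>] (0:ℝ)) (𝓝 0)) :
    Tendsto (fun x => ωm (ωd x) / x ^ (1 - 2 * σ)) (𝓝[>] (0:ℝ)) (𝓝 0) := by
  obtain ⟨C, hC⟩ := hlimsup
  have hp : 0 < 4 * α := by linarith
  have hq : 0 < 1 - 2 * σ := by linarith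
  have hr : 0 < (1 - 2 * σ) / (4 * α) := div_pos hq hp
  have hbound : Tendsto
      (fun x => C ^ (4 * α)⁻¹ * (ωd x / x ^ (4 * α)) ^ ((1 - 2 * σ) / (4 * α)))
      (𝓝[>] (0:ℝ)) (𝓝 0) := by
    simpa [Real.zero_rpow hr.ne'] using
      (hlim.rpow_const (Or.inr hr.le)).const_mul (C ^ (4 * α)⁻¹)
  refine squeeze_zero' ?_ ?_ hbound
  · filter_upwards [self_mem_nhdsWithin] with x (hx : 0 < x)
    exact div_nonneg (hωm.2.2.1 _ (hωd.2.2.1 x hx)).le (Real.rpow_nonneg hx.le _)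
  · filter_upwards [self_mem_nhdsWithin, hωd.tendsto_nhdsGT_zero.eventually hC] with x
      (hx : 0 < x) hCx
    have hy := hωd.2.2.1 x hx
    have hz := hωm.2.2.1 _ hy
    rw [div_rpow_eq_rpow_mul_rpow (1 - 2 * σ) hx hy hz hp.ne']
    gcongr
end
end
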